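/- Let G = ([n], E) be a minimally 2-rigid graph with n ≥ 3 vertices, labelled so that 12 ∈ E. In the parametrised Laurent polynomial ring ℂ[a,c][y^±] with parameters a_{ij} (ij ∈ E, i < j) and c_{1,1}, c_{1,2}, and Laurent variables y_{ij,k} (ij ∈ E, i < j, k ∈ [2]), with the convention y_{st,k} := −y_{ts,k} for s > t, let I′_E be the ideal generated by f′_{ij} := y_{ij,1}·y_{ij,2} − a_{ij} for ij ∈ E, g′_{12,1} := c_{1,1} y_{12,1} + c_{1,2} y_{12,2}, and h′_{C,k} := Σ_{(s,t)∈C} y_{st,k} for each directed cycle C of G and k ∈ [2]. Then the generic root count ℓ_{I′_E, ℂ(a,c)} equals 4 · c₂(G). -/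

import Mathlib

open scoped BigOperators

set_option synthInstance.maxHeartbeats 1000000
set_option maxHeartbeats 1000000

noncomputable section

namespace PaperDefs

/-- Two complex realisations are congruent if they differ by a complex orthogonal
transformation followed by a translation. -/
def Congruent {n d : ℕ} (p q : Fin n → Fin d → ℂ) : Prop :=
  ∃ (A : Matrix (Fin d) (Fin d) ℂ) (x : Fin d → ℂ),
    A * A.transpose = 1 ∧ A.transpose * A = 1 ∧ ∀ i, p i = A.mulVec (q i) + x

/-- Two real realisations are congruent if they differ by an isometry of `ℝ^d`. -/
def RealCongruent {n d : ℕ} (p q : Fin n → Fin d → ℝ) : Prop :=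
  ∃ (A : Matrix (Fin d) (Fin d) ℝ) (x : Fin d → ℝ),
    A * A.transpose = 1 ∧ A.transpose * A = 1 ∧ ∀ i, p i = A.mulVec (q i) + x

/-- The complex rigidity map `f_{G,d}`, recording half the squared edge lengths. -/
def rigidityMap {n : ℕ} (G : SimpleGraph (Fin n)) (d : ℕ)
    (p : Fin n → Fin d → ℂ) : G.edgeSet → ℂ :=
  fun e => Sym2.lift ⟨fun i j => (2⁻¹ : ℂ) * ∑ k, (p i k - p j k) ^ 2,
    fun i j => by
      have h : ∀ k, (p i k - p j k) ^ 2 = (p j k - p i k) ^ 2 := fun k => by ring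
      simp only [h]⟩ (e : Sym2 (Fin n))

/-- A real framework `(G,p)` is rigid: every continuous edge-length-preserving motion
starting at `p` stays congruent to `p`. -/
def IsRigidFramework {n : ℕ} (G : SimpleGraph (Fin n)) (d : ℕ)
    (p : Fin n → Fin d → ℝ) : Prop :=
  ∀ q : ℝ → Fin n → Fin d → ℝ,
    ContinuousOn q (Set.Icc 0 1) → q 0 = p →
    (∀ t ∈ Set.Icc (0 : ℝ) 1, ∀ i j, G.Adj i j →
        ∑ k, (q t i k - q t j k) ^ 2 = ∑ k, (p i k - p j k) ^ 2) →
    ∀ t ∈ Set.Icc (0 : ℝ) 1, RealCongruent (q t) p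

/-- `G` is `d`-rigid: generic real realisations give rigid frameworks. -/
def IsRigidGraph {n : ℕ} (G : SimpleGraph (Fin n)) (d : ℕ) : Prop :=
  ∃ f : MvPolynomial (Fin n × Fin d) ℝ, f ≠ 0 ∧
    ∀ p : Fin n → Fin d → ℝ,
      MvPolynomial.eval (fun v => p v.1 v.2) f ≠ 0 → IsRigidFramework G d p

/-- `G` is minimally `d`-rigid. -/
def IsMinimallyRigidGraph {n : ℕ} (G : SimpleGraph (Fin n)) (d : ℕ) : Prop :=
  IsRigidGraph G d ∧ ∀ e ∈ G.edgeSet, ¬ IsRigidGraph (G.deleteEdges {e}) d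

/-- The set of congruence classes of a set of complex realisations. -/
def congClasses {n d : ℕ} (S : Set (Fin n → Fin d → ℂ)) :
    Set (Set (Fin n → Fin d → ℂ)) :=
  (fun q => {q' ∈ S | Congruent q q'}) '' S

/-- `c` is the `d`-realisation number of `G`: for generic complex `p` the fibre of the
rigidity map through `p` has exactly `c` congruence classes. -/
def IsRealisationNumber {n : ℕ} (G : SimpleGraph (Fin n)) (d : ℕ) (c : ℕ) : Prop :=
  0 < c ∧ ∃ f : MvPolynomial (Fin n × Fin d) ℂ, f ≠ 0 ∧
    ∀ p : Fin n → Fin d → ℂ,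
      MvPolynomial.eval (fun v => p v.1 v.2) f ≠ 0 →
        (congClasses {q | rigidityMap G d q = rigidityMap G d p}).ncard = c

/-- The Zariski closure of the image of the rigidity map `f_{G,d}`. -/
def rigidityImageClosure {n : ℕ} (G : SimpleGraph (Fin n)) (d : ℕ) :
    Set (G.edgeSet → ℂ) :=
  {lam | ∀ f : MvPolynomial G.edgeSet ℂ,
    (∀ p, MvPolynomial.eval (rigidityMap G d p) f = 0) → MvPolynomial.eval lam f = 0}

/-- The Laurent polynomial ring over `K` in variables indexed by `V`, realised as the
group algebra of the free abelian group on `V`. -/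
abbrev LaurentRing (K : Type*) [CommRing K] (V : Type*) : Type _ :=
  AddMonoidAlgebra K (V →₀ ℤ)

/-- The Laurent variable `x_v`. -/
def LX {K : Type*} [CommRing K] {V : Type*} (v : V) : LaurentRing K V :=
  AddMonoidAlgebra.single (Finsupp.single v 1) 1

/-- The inverse Laurent variable `x_v⁻¹`. -/
def LXinv {K : Type*} [CommRing K] {V : Type*} (v : V) : LaurentRing K V :=
  AddMonoidAlgebra.single (Finsupp.single v (-1)) 1

/-- The field of rational functions `ℂ(a)` in parameters indexed by `P`. -/
abbrev RatFuncField (P : Type*) : Type _ := FractionRing (MvPolynomial P ℂ)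

/-- The parameter `a_p` as an element of `ℂ(a)`. -/
def ratParam {P : Type*} (p : P) : RatFuncField P :=
  algebraMap (MvPolynomial P ℂ) (RatFuncField P) (MvPolynomial.X p)

/-- The signed Laurent variable `y_{st,k}` attached to a dart (directed edge) of `G`:
it is `y_{e,k}` if the dart is increasingly oriented and `-y_{e,k}` otherwise, where `e`
is the underlying undirected edge. -/
def ydir {n : ℕ} {G : SimpleGraph (Fin n)} (K : Type*) [CommRing K] {d : ℕ}
    (dd : G.Dart) (k : Fin d) : LaurentRing K (↥G.edgeSet × Fin d) :=
  if dd.toProd.1 < dd.toProd.2 then LX (⟨dd.edge, dd.edge_mem⟩, k)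
  else - LX (⟨dd.edge, dd.edge_mem⟩, k)

/-- The signed Laurent variable `y_{st}` attached to a dart of `G` (single-variable
version). -/
def ydirE {n : ℕ} {G : SimpleGraph (Fin n)} (K : Type*) [CommRing K]
    (dd : G.Dart) : LaurentRing K ↥G.edgeSet :=
  if dd.toProd.1 < dd.toProd.2 then LX ⟨dd.edge, dd.edge_mem⟩
  else - LX ⟨dd.edge, dd.edge_mem⟩

/-- The signed inverse Laurent variable `y_{st}⁻¹` attached to a dart of `G`. -/
def ydirEinv {n : ℕ} {G : SimpleGraph (Fin n)} (K : Type*) [CommRing K]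
    (dd : G.Dart) : LaurentRing K ↥G.edgeSet :=
  if dd.toProd.1 < dd.toProd.2 then LXinv ⟨dd.edge, dd.edge_mem⟩
  else - LXinv ⟨dd.edge, dd.edge_mem⟩

open Cardinal in
/-- A field of cardinality at most the continuum that extends a countable subfield `k` of `ℂ`
embeds into `ℂ` over `k`. -/
theorem exists_algHom_complex_of_countable {k : Type} [Field k] [Algebra k ℂ] (hk : #k ≤ ℵ₀)
    (L : Type) [Field L] [Algebra k L] (hL : #L ≤ 𝔠) : Nonempty (L →ₐ[k] ℂ) := by
  obtain ⟨s, hs⟩ := exists_isTranscendenceBasis k L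
  obtain ⟨t, ht⟩ := exists_isTranscendenceBasis k ℂ
  have htc : #ℂ = #t := IsAlgClosed.cardinal_eq_cardinal_transcendence_basis_of_aleph0_lt' _ ht hk
    (by rw [mk_complex]; exact aleph0_lt_continuum)
  have hst : #s ≤ #t := by
    rw [← htc, mk_complex]
    exact (mk_set_le s).trans hL
  obtain ⟨e⟩ := hst
  have hw : AlgebraicIndependent k (fun i : s => ((e i : t) : ℂ)) := ht.1.comp e e.injective
  let g : Algebra.adjoin k (Set.range ((↑) : s → L)) →ₐ[k] ℂ :=
    (MvPolynomial.aeval fun i : s => ((e i : t) : ℂ)).comp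
      (hs.1.aevalEquiv.symm : Algebra.adjoin k (Set.range ((↑) : s → L)) →ₐ[k] MvPolynomial s k)
  have hg : Function.Injective g :=
    (show Function.Injective (MvPolynomial.aeval fun i : s => ((e i : t) : ℂ)) from hw).comp
      hs.1.aevalEquiv.symm.injective
  let : Algebra (Algebra.adjoin k (Set.range ((↑) : s → L))) ℂ := g.toRingHom.toAlgebra
  have : IsScalarTower k (Algebra.adjoin k (Set.range ((↑) : s → L))) ℂ :=
    IsScalarTower.of_algebraMap_eq fun x => (g.commutes x).symm
  have : Algebra.IsAlgebraic (Algebra.adjoin k (Set.range ((↑) : s → L))) L := hs.isAlgebraic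
  have : Module.IsTorsionFree (Algebra.adjoin k (Set.range ((↑) : s → L))) ℂ :=
    Module.isTorsionFree_iff_algebraMap_injective.mpr hg
  exact ⟨(IsAlgClosed.lift :
    L →ₐ[Algebra.adjoin k (Set.range ((↑) : s → L))] ℂ).restrictScalars k⟩

open Cardinal in
/-- A nonzero complex polynomial is nonzero at the image of the variables under a suitable
(not `ℂ`-linear) embedding of the polynomial ring into `ℂ`. -/
theorem exists_injective_ringHom_complex {σ : Type} [Finite σ] (F : MvPolynomial σ ℂ)
    (hF : F ≠ 0) : ∃ f : MvPolynomial σ ℂ →+* ℂ, Function.Injective f ∧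
      MvPolynomial.eval (fun i => f (MvPolynomial.X i)) F ≠ 0 := by
  let k : Subfield ℂ := Subfield.closure (F.coeffs : Set ℂ)
  have hk : #k ≤ ℵ₀ := by
    refine (Subfield.cardinalMk_closure_le_max _).trans ?_
    simp
  have hL : #(FractionRing (MvPolynomial σ ℂ)) ≤ 𝔠 := by
    refine (IsLocalization.cardinalMk_le (nonZeroDivisors (MvPolynomial σ ℂ))).trans ?_
    refine MvPolynomial.cardinalMk_le_max.trans ?_
    rw [mk_complex]
    exact max_le (max_le le_rfl ((lt_aleph0_of_finite σ).le.trans aleph0_le_continuum))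
      aleph0_le_continuum
  obtain ⟨g⟩ := exists_algHom_complex_of_countable hk (FractionRing (MvPolynomial σ ℂ)) hL
  let f : MvPolynomial σ ℂ →+* ℂ :=
    g.toRingHom.comp (algebraMap (MvPolynomial σ ℂ) (FractionRing (MvPolynomial σ ℂ)))
  have hf : Function.Injective f :=
    g.toRingHom.injective.comp (IsFractionRing.injective _ _)
  refine ⟨f, hf, ?_⟩
  obtain ⟨F₀, hF₀⟩ : F ∈ Set.range (MvPolynomial.map (σ := σ) (algebraMap k ℂ)) := by
    rw [MvPolynomial.mem_range_map_iff_coeffs_subset]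
    intro x hx
    exact ⟨⟨x, Subfield.subset_closure hx⟩, rfl⟩
  have key : f F = MvPolynomial.eval (fun i => f (MvPolynomial.X i)) F := by
    rw [← hF₀]
    simp only [MvPolynomial.eval_map]
    change (f.comp (MvPolynomial.map (algebraMap k ℂ))) F₀ =
      (MvPolynomial.eval₂Hom (algebraMap k ℂ) _) F₀
    congr 1
    ext x
    · have := g.commutes x
      simpa [f, IsScalarTower.algebraMap_apply k (MvPolynomial σ ℂ)
        (FractionRing (MvPolynomial σ ℂ)), MvPolynomial.algebraMap_eq,
        IsScalarTower.algebraMap_apply k ℂ (MvPolynomial σ ℂ)] using this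
    · simp
  rw [← key]
  exact fun h => hF (hf (h.trans (map_zero f).symm))

/-- A domain with an embedding but only finitely many homomorphisms into an algebraically closed
extension of `K` is algebraic over `K`. -/
theorem isAlgebraic_of_finite_algHom {K R Ω : Type*} [Field K] [CharZero K] [CommRing R]
    [IsDomain R] [Algebra K R] [Field Ω] [IsAlgClosed Ω] [Algebra K Ω] (φ : R →ₐ[K] Ω)
    (hφ : Function.Injective φ) [Finite (R →ₐ[K] Ω)] : Algebra.IsAlgebraic K R := by
  classical
  obtain ⟨s, hs⟩ := exists_isTranscendenceBasis K R
  rcases isEmpty_or_nonempty s with hse | ⟨⟨i₀⟩⟩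
  · exact hs.isEmpty_iff_isAlgebraic.mp hse
  exfalso
  let A := Algebra.adjoin K (Set.range ((↑) : s → R))
  let shift (a : K) : MvPolynomial s K →ₐ[K] MvPolynomial s K :=
    MvPolynomial.aeval fun i => MvPolynomial.X i + if i = i₀ then MvPolynomial.C a else 0
  have hshift (a : K) : Function.Injective (shift a) := by
    have : (shift (-a)).comp (shift a) = AlgHom.id K _ := by
      ext i
      by_cases hi : i = i₀ <;> simp [shift, hi]
    exact Function.LeftInverse.injective (g := shift (-a)) fun x => DFunLike.congr_fun this x
  have hψ (a : K) : ∃ ψ : R →ₐ[K] Ω, ψ (i₀ : R) = φ (i₀ : R) + algebraMap K Ω a := by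
    let g : A →ₐ[K] Ω := ((φ.comp (MvPolynomial.aeval ((↑) : s → R))).comp (shift a)).comp
      (hs.1.aevalEquiv.symm : A →ₐ[K] MvPolynomial s K)
    have hg : Function.Injective g :=
      ((hφ.comp (show Function.Injective (MvPolynomial.aeval ((↑) : s → R)) from hs.1)).comp
        (hshift a)).comp hs.1.aevalEquiv.symm.injective
    let : Algebra A Ω := g.toRingHom.toAlgebra
    have : IsScalarTower K A Ω := IsScalarTower.of_algebraMap_eq fun x => (g.commutes x).symm
    have : Algebra.IsAlgebraic A R := hs.isAlgebraic
    have : Module.IsTorsionFree A Ω := Module.isTorsionFree_iff_algebraMap_injective.mpr hg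
    refine ⟨(IsAlgClosed.lift : R →ₐ[A] Ω).restrictScalars K, ?_⟩
    have hi₀ : hs.1.aevalEquiv (MvPolynomial.X i₀) = ⟨(i₀ : R), Algebra.subset_adjoin ⟨i₀, rfl⟩⟩ :=
      Subtype.ext (by simp)
    have h1 := (IsAlgClosed.lift : R →ₐ[A] Ω).commutes (hs.1.aevalEquiv (MvPolynomial.X i₀))
    have h2 : algebraMap A Ω (hs.1.aevalEquiv (MvPolynomial.X i₀)) =
        φ (i₀ : R) + algebraMap K Ω a := by
      change g _ = _
      simp [g, shift]
    rw [h2, hi₀] at h1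
    exact h1
  choose ψ hψ using hψ
  have : Function.Injective fun m : ℕ => ψ (m : K) := by
    intro m m' h
    have h' := hψ (m : K)
    simp only at h
    rw [h, hψ] at h'
    exact Nat.cast_injective (R := K) ((algebraMap K Ω).injective (add_left_cancel h'.symm))
  exact not_injective_infinite_finite _ this

/-- If a finitely generated `K`-domain has finitely many points in an algebraically closed field,
one of which is an embedding, then it is a field and its dimension is the number of points. -/
theorem isField_and_finrank_eq_card_algHom {K R Ω : Type*} [Field K] [CharZero K] [CommRing R]
    [IsDomain R] [Algebra K R] [Field Ω] [IsAlgClosed Ω] [Algebra K Ω]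
    (φ : R →ₐ[K] Ω) (hφ : Function.Injective φ) [Finite (R →ₐ[K] Ω)] :
    IsField R ∧ Module.finrank K R = Nat.card (R →ₐ[K] Ω) := by
  have hR := isAlgebraic_of_finite_algHom φ hφ
  have : Algebra.IsIntegral K R := inferInstance
  have hF : IsField R := isField_of_isIntegral_of_isField' (Field.toIsField K)
  refine ⟨hF, ?_⟩
  let := hF.toField
  rw [← Field.finSepDegree_eq_of_isAlgClosed K R Ω,
    Field.finSepDegree_eq_finrank_of_isSeparable]

section Potential

variable {V M : Type*} {G : SimpleGraph V} [AddCommGroup M] {h : G.Dart → M}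

/-- A skew-symmetric function on darts with vanishing cycle sums has the same sum along a walk and
along the path obtained by removing its detours. -/
theorem sum_darts_bypass [DecidableEq V] (hsymm : ∀ d : G.Dart, h d.symm = -h d)
    (hcyc : ∀ (v : V) (w : G.Walk v v), w.IsCycle → (w.darts.map h).sum = 0)
    {u v : V} (w : G.Walk u v) : (w.bypass.darts.map h).sum = (w.darts.map h).sum := by
  induction w with
  | nil => rfl
  | @cons u v x ha p ih =>
    rw [SimpleGraph.Walk.bypass]
    split_ifs with hs
    · have hp : p.bypass.IsPath := p.bypass_isPath
      set p' := p.bypass with hp'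
      have hsplit : (p'.darts.map h).sum =
          ((p'.takeUntil u hs).darts.map h).sum + ((p'.dropUntil u hs).darts.map h).sum := by
        conv_lhs => rw [← p'.take_spec hs]
        simp only [SimpleGraph.Walk.darts_append, List.map_append, List.sum_append]
      have hclosed : h ⟨(u, v), ha⟩ + ((p'.takeUntil u hs).darts.map h).sum = 0 := by
        have ht : (p'.takeUntil u hs).IsPath := hp.takeUntil hs
        generalize p'.takeUntil u hs = t at ht ⊢
        by_cases he : s(u, v) ∈ t.edges
        · have hlen : t = SimpleGraph.Walk.cons ha.symm SimpleGraph.Walk.nil := by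
            have hsnd := ht.eq_snd_of_mem_edges (Sym2.eq_swap ▸ he)
            cases t with
            | nil => exact absurd ha (G.irrefl)
            | cons hb q =>
              rw [show (SimpleGraph.Walk.cons hb q).snd = q.getVert 0 from rfl,
                SimpleGraph.Walk.getVert_zero] at hsnd
              subst hsnd
              have hq : q.IsPath := (SimpleGraph.Walk.cons_isPath_iff _ _).mp ht |>.1
              rw [(SimpleGraph.Walk.isPath_iff_nil.mp hq).eq_nil]
          rw [hlen]
          have := hsymm ⟨(u, v), ha⟩
          simp only [SimpleGraph.Walk.darts_cons, SimpleGraph.Walk.darts_nil, List.map_cons,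
            List.map_nil, List.sum_cons, List.sum_nil, add_zero]
          rw [show (⟨(v, u), ha.symm⟩ : G.Dart) = SimpleGraph.Dart.symm ⟨(u, v), ha⟩ from rfl, this,
            add_neg_cancel]
        · have := hcyc u (SimpleGraph.Walk.cons ha t)
            ((SimpleGraph.Walk.cons_isCycle_iff _ _).mpr ⟨ht, he⟩)
          simpa using this
      have h3 : h ⟨(u, v), ha⟩ + (p.darts.map h).sum = ((p'.dropUntil u hs).darts.map h).sum := by
        rw [← ih, hsplit, ← add_assoc, hclosed, zero_add]
      simpa using h3.symm
    · simp [ih]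

/-- On a connected graph a skew-symmetric function on darts with vanishing cycle sums is the
difference of a function on vertices. -/
theorem exists_potential (hG : G.Connected) (hsymm : ∀ d : G.Dart, h d.symm = -h d)
    (hcyc : ∀ (v : V) (w : G.Walk v v), w.IsCycle → (w.darts.map h).sum = 0) (o : V) :
    ∃ U : V → M, U o = 0 ∧ ∀ d : G.Dart, h d = U d.fst - U d.snd := by
  classical
  have hclosed {v : V} (w : G.Walk v v) : (w.darts.map h).sum = 0 := by
    rw [← sum_darts_bypass hsymm hcyc w,
      (SimpleGraph.Walk.isPath_iff_nil.mp w.bypass_isPath).eq_nil]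
    rfl
  have hrev {u v : V} (w : G.Walk u v) : (w.reverse.darts.map h).sum = -(w.darts.map h).sum := by
    have := hclosed (w.append w.reverse)
    rw [SimpleGraph.Walk.darts_append, List.map_append, List.sum_append] at this
    exact (neg_eq_of_add_eq_zero_right this).symm
  let P (v : V) : G.Walk v o := (hG v o).some
  refine ⟨fun v => ((P v).darts.map h).sum, hclosed _, fun d => ?_⟩
  have := hclosed ((SimpleGraph.Walk.cons d.adj (P d.snd)).append (P d.fst).reverse)
  rw [SimpleGraph.Walk.darts_append, List.map_append, List.sum_append, hrev] at this
  simp only [SimpleGraph.Walk.darts_cons, List.map_cons, List.sum_cons] at this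
  rw [add_neg_eq_zero] at this
  exact eq_sub_of_add_eq this

/-- The differences of a function on vertices sum to zero along closed walks. -/
theorem sum_darts_sub (U : V → M) {u v : V} (w : G.Walk u v) :
    (w.darts.map fun d => U d.fst - U d.snd).sum = U u - U v := by
  induction w with
  | nil => simp
  | cons ha p ih => simp [ih]

end Potential

open MvPolynomial in
theorem exists_eval_ne_zero {σ R : Type*} [CommRing R] [IsDomain R] [Infinite R]
    {f : MvPolynomial σ R} (hf : f ≠ 0) : ∃ x, eval x f ≠ 0 := by
  by_contra! h
  exact hf (MvPolynomial.funext fun x => by simpa using h x)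

/-- Orthogonal matrices preserve the standard quadratic form. -/
theorem sum_sq_mulVec {R : Type*} [CommRing R] {d : ℕ} {A : Matrix (Fin d) (Fin d) R}
    (hA : A.transpose * A = 1) (v : Fin d → R) :
    ∑ k, (A.mulVec v k) ^ 2 = ∑ k, v k ^ 2 := by
  have h : A.mulVec v ⬝ᵥ A.mulVec v = v ⬝ᵥ v := by
    rw [Matrix.dotProduct_mulVec, ← Matrix.mulVec_transpose, Matrix.mulVec_mulVec, hA,
      Matrix.one_mulVec]
  simpa [dotProduct, pow_two] using h

theorem RealCongruent.sum_sq_eq {n d : ℕ} {p q : Fin n → Fin d → ℝ} (h : RealCongruent p q)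
    (i j : Fin n) : ∑ k, (p i k - p j k) ^ 2 = ∑ k, (q i k - q j k) ^ 2 := by
  obtain ⟨A, x, -, hA, hp⟩ := h
  rw [← sum_sq_mulVec hA (fun k => q i k - q j k)]
  refine Finset.sum_congr rfl fun k _ => ?_
  rw [show (fun k => q i k - q j k) = q i - q j from rfl, Matrix.mulVec_sub, hp, hp]
  simp

/-- A rigid graph in positive dimension is connected. -/
theorem IsRigidGraph.connected {n d : ℕ} [NeZero n] [NeZero d] {G : SimpleGraph (Fin n)}
    (hG : IsRigidGraph G d) : G.Connected := by
  classical
  have : Nonempty (Fin n) := ⟨0⟩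
  refine ⟨fun u v => ?_⟩
  by_contra huv
  obtain ⟨f, hf, hrig⟩ := hG
  obtain ⟨x, hx⟩ := exists_eval_ne_zero hf
  let p : Fin n → Fin d → ℝ := fun i k => x (i, k)
  let q : ℝ → Fin n → Fin d → ℝ := fun t i k =>
    p i k + if G.Reachable u i ∧ k = 0 then t else 0
  have hcont : Continuous q := by
    refine continuous_pi fun i => continuous_pi fun k => ?_
    by_cases h : G.Reachable u i ∧ k = 0
    · simp only [q, h, and_self, if_true]; fun_prop
    · simp only [q, h, if_false]; fun_prop
  have hcongr := hrig p hx q hcont.continuousOn (by funext i k; simp [q]) (by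
    intro t _ i j hij
    have : G.Reachable u i ↔ G.Reachable u j :=
      ⟨fun h => h.trans hij.reachable, fun h => h.trans hij.symm.reachable⟩
    simp [q, this])
  have hdiff (t : ℝ) (ht : t ∈ Set.Icc (0 : ℝ) 1) :
      (p u 0 - p v 0 + t) ^ 2 = (p u 0 - p v 0) ^ 2 := by
    have h := (hcongr t ht).sum_sq_eq u v
    rw [← Finset.add_sum_erase _ _ (Finset.mem_univ (0 : Fin d)),
      ← Finset.add_sum_erase _ _ (Finset.mem_univ (0 : Fin d))] at h
    have h' : ∑ k ∈ Finset.univ.erase (0 : Fin d), (q t u k - q t v k) ^ 2 =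
        ∑ k ∈ Finset.univ.erase (0 : Fin d), (p u k - p v k) ^ 2 :=
      Finset.sum_congr rfl fun k hk => by simp [q, (Finset.mem_erase.mp hk).1]
    rw [h', add_left_inj] at h
    rw [← h]
    simp [q, huv]
    ring
  have h1 := hdiff 1 (by norm_num)
  have h2 := hdiff (1 / 2) (by norm_num)
  linarith

/-- The squared length of an edge, as a polynomial in the coordinates. -/
def lengthPoly {n : ℕ} (d : ℕ) (e : Sym2 (Fin n)) : MvPolynomial (Fin n × Fin d) ℝ :=
  ∑ k, (MvPolynomial.X (e.inf, k) - MvPolynomial.X (e.sup, k)) ^ 2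

theorem eval_lengthPoly {n d : ℕ} (p : Fin n → Fin d → ℝ) (i j : Fin n) :
    MvPolynomial.eval (fun v => p v.1 v.2) (lengthPoly d s(i, j)) =
      ∑ k, (p i k - p j k) ^ 2 := by
  simp only [lengthPoly, map_sum, map_pow, map_sub, MvPolynomial.eval_X, Sym2.inf_mk, Sym2.sup_mk]
  refine Finset.sum_congr rfl fun k _ => ?_
  rcases le_total i j with h | h
  · simp [h]
  · simp only [h, inf_of_le_right, sup_of_le_left]; ring

/-- Removing an edge whose length is algebraic over the other edge lengths preserves rigidity. -/
theorem IsRigidGraph.deleteEdges_of_isAlgebraic {n d : ℕ} {G : SimpleGraph (Fin n)}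
    (hG : IsRigidGraph G d) {e : Sym2 (Fin n)} {T : Set (Sym2 (Fin n))}
    (hT : T ⊆ (G.deleteEdges {e}).edgeSet)
    (he : IsAlgebraic (Algebra.adjoin ℝ (lengthPoly d '' T)) (lengthPoly d e)) :
    IsRigidGraph (G.deleteEdges {e}) d := by
  obtain ⟨f, hf, hrig⟩ := hG
  obtain ⟨g, hg, hge⟩ := he
  refine ⟨f * (g.leadingCoeff : MvPolynomial (Fin n × Fin d) ℝ), mul_ne_zero hf (by simpa using hg),
    fun p hp q hq hq0 hlen => ?_⟩
  rw [map_mul, mul_ne_zero_iff] at hp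
  refine hrig p hp.1 q hq hq0 fun t ht i j hij => ?_
  by_cases hije : s(i, j) = e
  swap
  · exact hlen t ht i j (by simp [hij, hije])
  let ev (t : ℝ) : MvPolynomial (Fin n × Fin d) ℝ →ₐ[ℝ] ℝ :=
    MvPolynomial.aeval fun v => q t v.1 v.2
  have hev (t : ℝ) (i j : Fin n) : ev t (lengthPoly d s(i, j)) = ∑ k, (q t i k - q t j k) ^ 2 := by
    simpa [ev, MvPolynomial.aeval_eq_eval] using eval_lengthPoly (q t) i j
  have hconst (t : ℝ) (ht : t ∈ Set.Icc (0 : ℝ) 1) :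
      Algebra.adjoin ℝ (lengthPoly d '' T) ≤ AlgHom.equalizer (ev t) (ev 0) := by
    refine AlgHom.adjoin_le_equalizer _ _ ?_
    rintro _ ⟨s, hs, rfl⟩
    induction s using Sym2.ind with
    | _ a b => rw [hev, hev, hlen t ht a b (hT hs), hq0]
  let φ (t : ℝ) : Algebra.adjoin ℝ (lengthPoly d '' T) →+* ℝ :=
    (ev t).toRingHom.comp (algebraMap _ _)
  have hφ (t : ℝ) (ht : t ∈ Set.Icc (0 : ℝ) 1) : φ t = φ 0 :=
    RingHom.ext fun x => hconst t ht x.2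
  have hg0 : g.map (φ 0) ≠ 0 := by
    have hlead : φ 0 g.leadingCoeff ≠ 0 := by
      have h := hp.2
      rw [← hq0, ← MvPolynomial.coe_aeval_eq_eval] at h
      exact h
    intro h
    have := Polynomial.leadingCoeff_map_of_leadingCoeff_ne_zero (φ 0) hlead
    rw [h, Polynomial.leadingCoeff_zero] at this
    exact hlead this.symm
  have hroot (t : ℝ) (ht : t ∈ Set.Icc (0 : ℝ) 1) :
      (∑ k, (q t i k - q t j k) ^ 2) ∈ ((g.map (φ 0)).roots.toFinset : Set ℝ) := by
    simp only [Finset.mem_coe, Multiset.mem_toFinset, Polynomial.mem_roots hg0,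
      Polynomial.IsRoot.def]
    rw [← hφ t ht, ← hev, hije, Polynomial.eval_map]
    have := congrArg (ev t) hge
    rw [map_zero, Polynomial.aeval_def, ← AlgHom.coe_toRingHom, Polynomial.hom_eval₂] at this
    exact this
  have hqc : ContinuousOn (fun t => ∑ k, (q t i k - q t j k) ^ 2) (Set.Icc 0 1) := by
    have hc (i : Fin n) (k : Fin d) : ContinuousOn (fun t => q t i k) (Set.Icc 0 1) :=
      continuousOn_pi.mp (continuousOn_pi.mp hq i) k
    exact continuousOn_finsetSum _ fun k _ => ((hc i k).sub (hc j k)).pow 2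
  have hcst := isPreconnected_Icc.constant_of_mapsTo
    (Finset.finite_toSet _).isDiscrete hqc hroot ht
    (Set.left_mem_Icc.mpr zero_le_one)
  simpa [hq0] using hcst

/-- The edge lengths of a minimally rigid graph are algebraically independent. -/
theorem IsMinimallyRigidGraph.algebraicIndependent {n d : ℕ} {G : SimpleGraph (Fin n)}
    (hG : IsMinimallyRigidGraph G d) :
    AlgebraicIndependent ℝ fun e : G.edgeSet => lengthPoly d (e : Sym2 (Fin n)) := by
  refine algebraicIndependent_of_finite_type' (FaithfulSMul.algebraMap_injective _ _) ?_
  intro t _ _ e het halg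
  refine hG.2 e e.2 (hG.1.deleteEdges_of_isAlgebraic (T := (↑) '' t) ?_ ?_)
  · rintro _ ⟨s, hs, rfl⟩
    rw [SimpleGraph.edgeSet_deleteEdges]
    refine ⟨s.2, fun h => het ?_⟩
    rwa [← Subtype.ext (Set.mem_singleton_iff.mp h)]
  · rwa [Set.image_image]

/-- The product of the two coordinate differences along an edge. -/
def edgeProd {n : ℕ} {A : Type*} [CommRing A] (p : Fin n → Fin 2 → A) (e : Sym2 (Fin n)) : A :=
  (p e.inf 0 - p e.sup 0) * (p e.inf 1 - p e.sup 1)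

theorem edgeProd_mk {n : ℕ} {A : Type*} [CommRing A] (p : Fin n → Fin 2 → A) (i j : Fin n) :
    edgeProd p s(i, j) = (p i 0 - p j 0) * (p i 1 - p j 1) := by
  rcases le_total i j with h | h
  · simp [edgeProd, h]
  · simp only [edgeProd, Sym2.inf_mk, Sym2.sup_mk, h, inf_of_le_right, sup_of_le_left]; ring

open MvPolynomial in
/-- A complex polynomial vanishing on the edge products of all complex realisations of a
minimally 2-rigid graph is zero. -/
theorem IsMinimallyRigidGraph.eq_zero_of_eval_edgeProd {n : ℕ} {G : SimpleGraph (Fin n)}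
    (hG : IsMinimallyRigidGraph G 2) (P : MvPolynomial G.edgeSet ℂ)
    (hP : ∀ p : Fin n → Fin 2 → ℂ, eval (fun e : G.edgeSet => edgeProd p e) P = 0) : P = 0 := by
  have hlin (L : ℂ →ₗ[ℝ] ℝ) (m : G.edgeSet →₀ ℕ) : L (coeff m P) = 0 := by
    let Q : MvPolynomial G.edgeSet ℝ := ∑ m ∈ P.support, monomial m (L (coeff m P))
    have hQeval (x : G.edgeSet → ℝ) : eval x Q = L (eval (fun e => (x e : ℂ)) P) := by
      rw [eval_eq (X := fun e => (x e : ℂ)), map_sum, map_sum]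
      refine Finset.sum_congr rfl fun m _ => ?_
      rw [eval_monomial, mul_comm (coeff m P), mul_comm (L _), Finsupp.prod,
        ← smul_eq_mul (∏ i ∈ m.support, x i ^ m i), ← map_smul, Complex.real_smul]
      push_cast
      rfl
    have hQ : Q = 0 := by
      refine hG.algebraicIndependent.eq_zero_of_aeval_eq_zero _ ?_
      refine MvPolynomial.funext fun r => ?_
      rw [map_zero, ← coe_aeval_eq_eval, AlgHom.coe_toRingHom, ← AlgHom.comp_apply, comp_aeval,
        aeval_eq_eval, hQeval, ← map_zero L]
      congr 1
      rw [← hP fun i => ![r (i, 0) + Complex.I * r (i, 1), r (i, 0) - Complex.I * r (i, 1)]]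
      congr 2
      funext e
      have : Complex.I ^ 2 = -1 := Complex.I_sq
      simp [lengthPoly, edgeProd, Fin.sum_univ_two, aeval_eq_eval]
      linear_combination (((r ((e : Sym2 _).inf, 1) : ℂ) - r ((e : Sym2 _).sup, 1)) ^ 2) * this
    have := congrArg (coeff m) hQ
    simp only [Q, coeff_sum, coeff_monomial, coeff_zero, Finset.sum_ite_eq'] at this
    by_cases hm : m ∈ P.support
    · simpa [hm] using this
    · rw [notMem_support_iff.mp hm, map_zero]
  ext m
  exact Complex.ext (hlin Complex.reLm m) (hlin Complex.imLm m)

/-- The realisations with prescribed edge products whose vertex `0` is at the origin and whose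
edge `01` satisfies a linear equation. -/
def pinnedSolutions {n : ℕ} [NeZero n] {A : Type*} [CommRing A] (G : SimpleGraph (Fin n))
    (a : G.edgeSet → A) (c : Fin 2 → A) : Set (Fin n → Fin 2 → A) :=
  {p | p 0 = 0 ∧ (∀ e : G.edgeSet, edgeProd p e = a e) ∧ c 0 * p 1 0 + c 1 * p 1 1 = 0}

theorem Congruent.symm {n d : ℕ} {p q : Fin n → Fin d → ℂ} (h : Congruent p q) :
    Congruent q p := by
  obtain ⟨A, x, h1, h2, h⟩ := h
  refine ⟨A.transpose, -A.transpose.mulVec x, by simpa using h2, by simpa using h1, fun i => ?_⟩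
  rw [h i, Matrix.mulVec_add, Matrix.mulVec_mulVec, h2, Matrix.one_mulVec, add_neg_cancel_right]

theorem Congruent.trans {n d : ℕ} {p q r : Fin n → Fin d → ℂ} (h : Congruent p q)
    (h' : Congruent q r) : Congruent p r := by
  obtain ⟨A, x, h1, h2, h⟩ := h
  obtain ⟨B, y, h1', h2', h'⟩ := h'
  refine ⟨A * B, A.mulVec y + x, ?_, ?_, fun i => ?_⟩
  · rw [Matrix.transpose_mul, Matrix.mul_assoc, ← Matrix.mul_assoc B, h1', Matrix.one_mul, h1]
  · rw [Matrix.transpose_mul, Matrix.mul_assoc, ← Matrix.mul_assoc A.transpose, h2,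
      Matrix.one_mul, h2']
  · rw [h i, h' i, Matrix.mulVec_add, Matrix.mulVec_mulVec, add_assoc]

theorem congruent_sub_const {n d : ℕ} (p : Fin n → Fin d → ℂ) (x : Fin d → ℂ) :
    Congruent p (fun i => p i - x) :=
  ⟨1, x, by simp, by simp, fun i => by simp⟩

theorem Congruent.refl {n d : ℕ} (p : Fin n → Fin d → ℂ) : Congruent p p := by
  simpa using congruent_sub_const p 0

/-- The coordinates `x + iy`, `x - iy` of a planar realisation. -/
def toIsotropic {n : ℕ} (q : Fin n → Fin 2 → ℂ) : Fin n → Fin 2 → ℂ :=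
  fun i => ![q i 0 + Complex.I * q i 1, q i 0 - Complex.I * q i 1]

/-- The planar realisation with given isotropic coordinates `x + iy`, `x - iy`. -/
def ofIsotropic {n : ℕ} (p : Fin n → Fin 2 → ℂ) : Fin n → Fin 2 → ℂ :=
  fun i => ![(p i 0 + p i 1) / 2, -Complex.I * (p i 0 - p i 1) / 2]

theorem ofIsotropic_toIsotropic {n : ℕ} (q : Fin n → Fin 2 → ℂ) :
    ofIsotropic (toIsotropic q) = q := by
  funext i k
  have := Complex.I_sq
  fin_cases k
  · simp [ofIsotropic, toIsotropic]
  · simp [ofIsotropic, toIsotropic]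
    linear_combination (-q i 1) * this

theorem toIsotropic_ofIsotropic {n : ℕ} (q : Fin n → Fin 2 → ℂ) :
    toIsotropic (ofIsotropic q) = q := by
  funext i k
  have := Complex.I_sq
  fin_cases k
  · simp [ofIsotropic, toIsotropic]
    linear_combination (-(q i 0 - q i 1) / 2) * this
  · simp [ofIsotropic, toIsotropic]
    linear_combination ((q i 0 - q i 1) / 2) * this

theorem rigidityMap_eq_iff {n : ℕ} {G : SimpleGraph (Fin n)} {q q' : Fin n → Fin 2 → ℂ} :
    rigidityMap G 2 q = rigidityMap G 2 q' ↔
      ∀ e : G.edgeSet, edgeProd (toIsotropic q) e = edgeProd (toIsotropic q') e := by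
  have h (r : Fin n → Fin 2 → ℂ) (e : G.edgeSet) :
      edgeProd (toIsotropic r) e = 2 * rigidityMap G 2 r e := by
    obtain ⟨e, he⟩ := e
    induction e using Sym2.ind with
    | _ i j =>
      have := Complex.I_sq
      simp only [edgeProd_mk, rigidityMap, Sym2.lift_mk, Fin.sum_univ_two, toIsotropic,
        Matrix.cons_val_zero, Matrix.cons_val_one]
      linear_combination (-(r i 1 - r j 1) ^ 2) * this
  rw [funext_iff]
  exact forall_congr' fun e => by simp [h]

/-- Congruence of planar realisations fixing the origin, in isotropic coordinates. -/
theorem congruent_ofIsotropic_iff {n : ℕ} [NeZero n] {p q : Fin n → Fin 2 → ℂ} (hp : p 0 = 0)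
    (hq : q 0 = 0) : Congruent (ofIsotropic p) (ofIsotropic q) ↔ ∃ t : ℂ, t ≠ 0 ∧
      ((∀ i, p i 0 = t * q i 0 ∧ p i 1 = t⁻¹ * q i 1) ∨
        ∀ i, p i 0 = t * q i 1 ∧ p i 1 = t⁻¹ * q i 0) := by
  have hI := Complex.I_sq
  constructor
  · rintro ⟨A, x, -, hA, h⟩
    have hx : x = 0 := by
      have h0 := h 0
      have hz : ∀ r : Fin n → Fin 2 → ℂ, r 0 = 0 → ofIsotropic r 0 = 0 := fun r hr => by
        funext k; fin_cases k <;> simp [ofIsotropic, hr]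
      rw [hz p hp, hz q hq, Matrix.mulVec_zero, zero_add] at h0
      exact h0.symm
    have e00 := congrFun (congrFun hA 0) 0
    have e01 := congrFun (congrFun hA 0) 1
    have e11 := congrFun (congrFun hA 1) 1
    simp only [Matrix.mul_apply, Matrix.transpose_apply, Fin.sum_univ_two, Matrix.one_apply_eq,
      Matrix.one_apply_ne (zero_ne_one : (0 : Fin 2) ≠ 1)] at e00 e01 e11
    set I := Complex.I
    set m := (A 0 0 + A 1 1 + I * (A 1 0 - A 0 1)) / 2 with hm
    set m' := (A 0 0 - A 1 1 + I * (A 1 0 + A 0 1)) / 2 with hm'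
    set l' := (A 0 0 - A 1 1 - I * (A 1 0 + A 0 1)) / 2 with hl'
    set l := (A 0 0 + A 1 1 - I * (A 1 0 - A 0 1)) / 2 with hl
    have hp0 (i) : p i 0 = m * q i 0 + m' * q i 1 := by
      have h0 := congrFun (h i) 0
      have h1 := congrFun (h i) 1
      simp [ofIsotropic, hx] at h0 h1
      rw [hm, hm']
      linear_combination h0 + I * h1 + (1/2) * ((p i 0 - p i 1) + A 1 1 * (q i 1 - q i 0)) * hI
    have hp1 (i) : p i 1 = l' * q i 0 + l * q i 1 := by
      have h0 := congrFun (h i) 0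
      have h1 := congrFun (h i) 1
      simp [ofIsotropic, hx] at h0 h1
      rw [hl, hl']
      linear_combination h0 - I * h1 - (1/2) * ((p i 0 - p i 1) + A 1 1 * (q i 1 - q i 0)) * hI
    have hml' : m * l' = 0 := by
      rw [hm, hl']; linear_combination (e00 - e11 - 2 * I * e01) / 4 + ((A 0 1 ^2 - A 1 0 ^2) / 4) * hI
    have hm'l : m' * l = 0 := by
      rw [hm', hl]; linear_combination (e00 - e11 + 2 * I * e01) / 4 + ((A 0 1 ^2 - A 1 0 ^2) / 4) * hI
    have hone : m * l + m' * l' = 1 := by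
      rw [hm, hm', hl, hl']; linear_combination (e00 + e11) / 2 - ((A 0 1 ^2 + A 1 0 ^2) / 2) * hI
    rcases mul_eq_zero.mp hml' with h0 | h0
    · rw [h0, zero_mul, zero_add] at hone
      have hm0 : m' ≠ 0 := left_ne_zero_of_mul_eq_one hone
      have hl0 : l = 0 := (mul_eq_zero.mp hm'l).resolve_left hm0
      refine ⟨m', hm0, Or.inr fun i => ⟨by rw [hp0, h0]; ring, ?_⟩⟩
      rw [hp1, hl0, eq_inv_of_mul_eq_one_right hone]; ring
    · rw [h0, mul_zero, add_zero] at hone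
      have hm0 : m ≠ 0 := left_ne_zero_of_mul_eq_one hone
      have hl0 : m' = 0 := (mul_eq_zero.mp hm'l).resolve_right (right_ne_zero_of_mul_eq_one hone)
      refine ⟨m, hm0, Or.inl fun i => ⟨by rw [hp0, hl0]; ring, ?_⟩⟩
      rw [hp1, h0, eq_inv_of_mul_eq_one_right hone]; ring
  · rintro ⟨t, ht, h⟩
    have htt : t * t⁻¹ = 1 := mul_inv_cancel₀ ht
    rcases h with h | h
    · let A : Matrix (Fin 2) (Fin 2) ℂ := !![(t + t⁻¹) / 2, Complex.I * (t - t⁻¹) / 2;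
        -Complex.I * (t - t⁻¹) / 2, (t + t⁻¹) / 2]
      have hA : A * A.transpose = 1 := by
        ext i j
        fin_cases i <;> fin_cases j <;>
          simp [A, Matrix.mul_apply, Fin.sum_univ_two] <;>
          first
          | ring1
          | linear_combination htt + ((t - t⁻¹) ^ 2 / 4) * hI
      refine ⟨A, 0, hA, mul_eq_one_comm.mp hA, fun i => ?_⟩
      funext k
      fin_cases k
      · simp [A, ofIsotropic, h i]
        linear_combination ((t - t⁻¹) * (q i 0 - q i 1) / 4) * hI
      · simp [A, ofIsotropic, h i]
        ring
    · let A : Matrix (Fin 2) (Fin 2) ℂ := !![(t + t⁻¹) / 2, -Complex.I * (t - t⁻¹) / 2;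
        -Complex.I * (t - t⁻¹) / 2, -(t + t⁻¹) / 2]
      have hA : A * A.transpose = 1 := by
        ext i j
        fin_cases i <;> fin_cases j <;>
          simp [A, Matrix.mul_apply, Fin.sum_univ_two] <;>
          first
          | ring1
          | linear_combination htt + ((t - t⁻¹) ^ 2 / 4) * hI
      refine ⟨A, 0, hA, mul_eq_one_comm.mp hA, fun i => ?_⟩
      funext k
      fin_cases k
      · simp [A, ofIsotropic, h i]
        linear_combination (-(t - t⁻¹) * (q i 0 - q i 1) / 4) * hI
      · simp [A, ofIsotropic, h i]
        ring

/-- Every planar realisation whose edge `01` is non-isotropic can be moved, without changing its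
edge products, to one pinned at the origin whose edge `01` satisfies a given linear equation. -/
theorem exists_pinned_congruent {n : ℕ} [NeZero n] (p : Fin n → Fin 2 → ℂ) {c : Fin 2 → ℂ}
    (hc₀ : c 0 ≠ 0) (hc₁ : c 1 ≠ 0) (hp : edgeProd p s(0, 1) ≠ 0) :
    ∃ p' : Fin n → Fin 2 → ℂ, p' 0 = 0 ∧ (∀ e, edgeProd p' e = edgeProd p e) ∧
      c 0 * p' 1 0 + c 1 * p' 1 1 = 0 ∧ Congruent (ofIsotropic p') (ofIsotropic p) := by
  rw [edgeProd_mk] at hp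
  have h0 : p 1 0 - p 0 0 ≠ 0 := fun h => hp (by linear_combination (-(p 0 1 - p 1 1)) * h)
  have h1 : p 1 1 - p 0 1 ≠ 0 := fun h => hp (by linear_combination (-(p 0 0 - p 1 0)) * h)
  obtain ⟨t, ht⟩ := IsAlgClosed.exists_pow_nat_eq
    (-(c 1 * (p 1 1 - p 0 1)) / (c 0 * (p 1 0 - p 0 0))) two_pos
  have ht0 : t ≠ 0 := by
    rintro rfl
    have : -(c 1 * (p 1 1 - p 0 1)) / (c 0 * (p 1 0 - p 0 0)) ≠ 0 := by simp [*]
    exact this (by rw [← ht]; norm_num)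
  rw [eq_div_iff (mul_ne_zero hc₀ h0)] at ht
  have htt : t * t⁻¹ = 1 := mul_inv_cancel₀ ht0
  let p' : Fin n → Fin 2 → ℂ := fun i => ![t * (p i 0 - p 0 0), t⁻¹ * (p i 1 - p 0 1)]
  have hp0 : p' 0 = 0 := by funext k; fin_cases k <;> simp [p']
  refine ⟨p', hp0, fun e => ?_, ?_, ?_⟩
  · simp only [edgeProd, p', Matrix.cons_val_zero, Matrix.cons_val_one]
    linear_combination ((p e.inf 0 - p e.sup 0) * (p e.inf 1 - p e.sup 1)) * htt
  · simp only [p', Matrix.cons_val_zero, Matrix.cons_val_one]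
    linear_combination t⁻¹ * ht - c 0 * (p 1 0 - p 0 0) * t * htt
  · refine Congruent.trans (q := ofIsotropic fun i => p i - p 0) ?_ ?_
    · exact (congruent_ofIsotropic_iff hp0 (sub_self _)).mpr
        ⟨t, ht0, Or.inl fun i => ⟨by simp [p'], by simp [p']⟩⟩
    · have : ofIsotropic (fun i => p i - p 0) = fun i => ofIsotropic p i - ofIsotropic p 0 := by
        funext i k
        fin_cases k <;> simp [ofIsotropic] <;> ring
      rw [this]
      exact (congruent_sub_const _ _).symm

section Counting

variable {n : ℕ} [NeZero n] {G : SimpleGraph (Fin n)}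

/-- The pinned realisations congruent to a given one differ from it by a sign and a swap of the
isotropic coordinates. -/
theorem congruent_pinnedSolutions_iff (h01 : G.Adj 0 1) {a : G.edgeSet → ℂ} {c : Fin 2 → ℂ}
    (hc₀ : c 0 ≠ 0) (hc₁ : c 1 ≠ 0) (ha : ∀ e, a e ≠ 0) {s : Fin n → Fin 2 → ℂ}
    (hs : s ∈ pinnedSolutions G a c) (s' : Fin n → Fin 2 → ℂ) :
    s' ∈ pinnedSolutions G a c ∧ Congruent (ofIsotropic s') (ofIsotropic s) ↔
      s' = s ∨ s' = -s ∨ (s' = fun i => ![c 1 / c 0 * s i 1, c 0 / c 1 * s i 0]) ∨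
        s' = -fun i => ![c 1 / c 0 * s i 1, c 0 / c 1 * s i 0] := by
  obtain ⟨hs0, hse, hsl⟩ := hs
  have hprod := ha ⟨s(0, 1), h01⟩
  rw [← hse, edgeProd_mk, hs0] at hprod
  have h10 : s 1 0 ≠ 0 := fun h => hprod (by simp [h])
  have h11 : s 1 1 ≠ 0 := fun h => hprod (by simp [h])
  have hκ : c 1 / c 0 * (c 0 / c 1) = 1 := by field_simp
  constructor
  · rintro ⟨⟨hs0', -, hsl'⟩, hcong⟩
    obtain ⟨t, ht, h | h⟩ := (congruent_ofIsotropic_iff hs0' hs0).mp hcong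
    · rw [(h 1).1, (h 1).2] at hsl'
      have : (t - 1) * (t + 1) = 0 := by
        have h' : c 0 * s 1 0 * ((t - 1) * (t + 1)) = 0 := by
          linear_combination t * hsl' - hsl - c 1 * s 1 1 * mul_inv_cancel₀ ht
        exact (mul_eq_zero.mp h').resolve_left (mul_ne_zero hc₀ h10)
      rcases mul_eq_zero.mp this with h1 | h1
      · obtain rfl : t = 1 := by linear_combination h1
        left
        funext i k
        fin_cases k
        · simpa using (h i).1
        · simpa using (h i).2
      · obtain rfl : t = -1 := by linear_combination h1
        right; left
        funext i k
        fin_cases k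
        · simpa using (h i).1
        · simpa [inv_neg] using (h i).2
    · rw [(h 1).1, (h 1).2] at hsl'
      have : (t - c 1 / c 0) * (t + c 1 / c 0) = 0 := by
        have h' : c 0 ^ 2 * s 1 1 * ((t - c 1 / c 0) * (t + c 1 / c 0)) = 0 := by
          have e : c 0 * (c 1 / c 0) = c 1 := by field_simp
          linear_combination c 0 * t * hsl' - c 1 * hsl - c 0 * c 1 * s 1 0 * mul_inv_cancel₀ ht -
            s 1 1 * (c 0 * (c 1 / c 0) + c 1) * e
        exact (mul_eq_zero.mp h').resolve_left (mul_ne_zero (pow_ne_zero 2 hc₀) h11)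
      rcases mul_eq_zero.mp this with h1 | h1
      · obtain rfl : t = c 1 / c 0 := by linear_combination h1
        right; right; left
        funext i k
        fin_cases k
        · simpa using (h i).1
        · simpa using (h i).2
      · obtain rfl : t = -(c 1 / c 0) := by linear_combination h1
        right; right; right
        funext i k
        fin_cases k
        · simpa using (h i).1
        · simpa [inv_neg] using (h i).2
  · have key : ∀ t : ℂ, t ≠ 0 → ∀ s'' : Fin n → Fin 2 → ℂ,
        ((∀ i, s'' i 0 = t * s i 0 ∧ s'' i 1 = t⁻¹ * s i 1) ∨
          ∀ i, s'' i 0 = t * s i 1 ∧ s'' i 1 = t⁻¹ * s i 0) →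
        c 0 * s'' 1 0 + c 1 * s'' 1 1 = 0 →
        s'' ∈ pinnedSolutions G a c ∧ Congruent (ofIsotropic s'') (ofIsotropic s) := by
      intro t ht s'' h hl
      have htt := mul_inv_cancel₀ ht
      have h0 : s'' 0 = 0 := by
        funext k
        rcases h with h | h <;> fin_cases k <;> simp [h 0, hs0]
      refine ⟨⟨h0, fun e => ?_, hl⟩, (congruent_ofIsotropic_iff h0 hs0).mpr ⟨t, ht, h⟩⟩
      rw [← hse e]
      rcases h with h | h <;> simp only [edgeProd, h] <;>
        linear_combination
          ((s (e : Sym2 (Fin n)).inf 0 - s (e : Sym2 (Fin n)).sup 0) *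
            (s (e : Sym2 (Fin n)).inf 1 - s (e : Sym2 (Fin n)).sup 1)) * htt
    have hl₂ : c 0 * (c 1 / c 0 * s 1 1) + c 1 * (c 0 / c 1 * s 1 0) = 0 := by
      field_simp
      linear_combination hsl
    rintro (rfl | rfl | rfl | rfl)
    · exact key 1 one_ne_zero _ (Or.inl fun i => by simp) hsl
    · exact key (-1) (by norm_num) _ (Or.inl fun i => by simp [inv_neg])
        (by simp only [Pi.neg_apply]; linear_combination -hsl)
    · exact key (c 1 / c 0) (div_ne_zero hc₁ hc₀) _ (Or.inr fun i => by simp) (by simpa using hl₂)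
    · refine key (-(c 1 / c 0)) (neg_ne_zero.mpr (div_ne_zero hc₁ hc₀)) _
        (Or.inr fun i => by simp [inv_neg]) ?_
      simp only [Pi.neg_apply, Matrix.cons_val_zero, Matrix.cons_val_one]
      linear_combination -hl₂

/-- Pinned realisations with the edge products of `q₀` are finite in number, and four to one over
congruence classes, if the fibre of the rigidity map through `q₀` has finitely many classes. -/
theorem ncard_pinnedSolutions (h01 : G.Adj 0 1) {q₀ : Fin n → Fin 2 → ℂ} {a : G.edgeSet → ℂ}
    (ha : ∀ e, a e = edgeProd (toIsotropic q₀) e) (ha₀ : ∀ e, a e ≠ 0) {c : Fin 2 → ℂ}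
    (hc₀ : c 0 ≠ 0) (hc₁ : c 1 ≠ 0)
    (hfin : (congClasses {q | rigidityMap G 2 q = rigidityMap G 2 q₀}).Finite) :
    (pinnedSolutions G a c).Finite ∧
      ((∀ s ∈ pinnedSolutions G a c, ∃ v, c 0 * s v 0 + c 1 * s v 1 ≠ 0) →
        (pinnedSolutions G a c).ncard =
          4 * (congClasses {q | rigidityMap G 2 q = rigidityMap G 2 q₀}).ncard) := by
  classical
  let F := {q | rigidityMap G 2 q = rigidityMap G 2 q₀}
  let S := pinnedSolutions G a c
  have hmem {s : Fin n → Fin 2 → ℂ} (hs : s ∈ S) : ofIsotropic s ∈ F :=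
    rigidityMap_eq_iff.mpr fun e => by rw [toIsotropic_ofIsotropic, hs.2.1, ha]
  let π : (Fin n → Fin 2 → ℂ) → Set (Fin n → Fin 2 → ℂ) :=
    fun s => {q' ∈ F | Congruent (ofIsotropic s) q'}
  have hπ {s s' : Fin n → Fin 2 → ℂ} (hs' : s' ∈ S) :
      π s' = π s ↔ Congruent (ofIsotropic s') (ofIsotropic s) := by
    constructor
    · intro h
      have : ofIsotropic s' ∈ π s := h ▸ ⟨hmem hs', Congruent.refl _⟩
      exact this.2.symm
    · intro h
      ext q
      exact and_congr_right fun _ => ⟨fun h' => h.symm.trans h', fun h' => h.trans h'⟩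
  have himage : π '' S = congClasses F := by
    apply Set.Subset.antisymm
    · rintro _ ⟨s, hs, rfl⟩
      exact ⟨_, hmem hs, rfl⟩
    · rintro _ ⟨q, hq, rfl⟩
      have hqe := rigidityMap_eq_iff.mp hq
      obtain ⟨s, hs0, hse, hsl, hcong⟩ := exists_pinned_congruent (toIsotropic q) hc₀ hc₁
        (by rw [hqe ⟨s(0, 1), h01⟩, ← ha]; exact ha₀ _)
      rw [ofIsotropic_toIsotropic] at hcong
      refine ⟨s, ⟨hs0, fun e => by rw [hse, hqe, ha], hsl⟩, ?_⟩
      ext q'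
      exact and_congr_right fun _ => ⟨fun h' => hcong.symm.trans h', fun h' => hcong.trans h'⟩
  let ρ : (Fin n → Fin 2 → ℂ) → (Fin n → Fin 2 → ℂ) :=
    fun s i => ![c 1 / c 0 * s i 1, c 0 / c 1 * s i 0]
  have hfib {s : Fin n → Fin 2 → ℂ} (hs : s ∈ S) (s' : Fin n → Fin 2 → ℂ) :
      s' ∈ S ∧ π s' = π s ↔ s' ∈ ({s, -s, ρ s, -ρ s} : Finset (Fin n → Fin 2 → ℂ)) := by
    simp only [Finset.mem_insert, Finset.mem_singleton]
    rw [← congruent_pinnedSolutions_iff h01 hc₀ hc₁ ha₀ hs s']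
    exact and_congr_right fun h => hπ h
  have hSfin : S.Finite := by
    refine Set.Finite.of_finite_fibers π (himage ▸ hfin) ?_
    rintro _ ⟨s, hs, rfl⟩
    exact (Finset.finite_toSet {s, -s, ρ s, -ρ s}).subset fun s' hs' => (hfib hs s').mp hs'
  refine ⟨hSfin, fun hasym => ?_⟩
  have hcard4 {s : Fin n → Fin 2 → ℂ} (hs : s ∈ S) :
      ({s, -s, ρ s, -ρ s} : Finset (Fin n → Fin 2 → ℂ)).card = 4 := by
    obtain ⟨v, hv⟩ := hasym s hs
    obtain ⟨hs0, hse, hsl⟩ := hs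
    have hprod := ha₀ ⟨s(0, 1), h01⟩
    rw [← hse, edgeProd_mk, hs0] at hprod
    have h10 : s 1 0 ≠ 0 := fun h => hprod (by simp [h])
    have h11 : c 1 * s 1 1 ≠ 0 := mul_ne_zero hc₁ fun h => hprod (by simp [h])
    have e (i) : c 0 * ρ s i 0 = c 1 * s i 1 := by simp only [ρ, Matrix.cons_val_zero]; field_simp
    have hne₁ : s ≠ -s := fun h => h10 (by
      have := congrFun (congrFun h 1) 0
      simp only [Pi.neg_apply] at this
      linear_combination this / 2)
    have hne₂ : ρ s ≠ -ρ s := fun h => h11 (by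
      have := congrFun (congrFun h 1) 0
      simp only [Pi.neg_apply] at this
      rw [← e]
      linear_combination c 0 * this / 2)
    have hne₃ : s ≠ ρ s := fun h => h11 (by
      have := congrFun (congrFun h 1) 0
      linear_combination hsl / 2 - c 0 * this / 2 - e 1 / 2)
    have hne₄ : s ≠ -ρ s := fun h => hv (by
      have := congrFun (congrFun h v) 0
      simp only [Pi.neg_apply] at this
      linear_combination c 0 * this - e v)
    rw [Finset.card_insert_of_notMem, Finset.card_insert_of_notMem, Finset.card_pair hne₂]
    · simp only [Finset.mem_insert, Finset.mem_singleton, not_or, neg_inj]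
      exact ⟨fun h => hne₄ (by rw [← h, neg_neg]), hne₃⟩
    · simp only [Finset.mem_insert, Finset.mem_singleton, not_or]
      exact ⟨hne₁, hne₃, hne₄⟩
  change S.ncard = 4 * (congClasses F).ncard
  rw [← himage]
  lift S to Finset (Fin n → Fin 2 → ℂ) using hSfin with S' hS'
  rw [← Finset.coe_image, Set.ncard_coe_finset, Set.ncard_coe_finset,
    Finset.card_eq_sum_card_image π S', mul_comm]
  refine Finset.sum_const_nat fun x hx => ?_
  obtain ⟨s, hs, rfl⟩ := Finset.mem_image.mp hx
  rw [← hcard4 hs]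
  congr 1
  ext s'
  rw [Finset.mem_filter, ← hfib hs s', Finset.mem_coe]

end Counting

/-- Indices of the coordinates of a pinned realisation: the two coefficients of the linear
equation on the edge `01`, a scaling factor of that edge, and the coordinates of the remaining
vertices. -/
abbrev PinIdx (n : ℕ) [NeZero n] : Type := Fin 3 ⊕ {v : Fin n // v ≠ 0 ∧ v ≠ 1} × Fin 2

section Pinned

variable {n : ℕ} [NeZero n] {A B : Type*} [CommRing A] [CommRing B]

/-- The pinned realisation with given coordinates. -/
def pinned (x : PinIdx n → A) : Fin n → Fin 2 → A := fun v k =>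
  if h0 : v = 0 then 0
  else if h1 : v = 1 then ![-(x (Sum.inl 1) * x (Sum.inl 2)), x (Sum.inl 0) * x (Sum.inl 2)] k
  else x (Sum.inr (⟨v, h0, h1⟩, k))

theorem pinned_zero (x : PinIdx n → A) : pinned x 0 = 0 := by
  funext k
  simp [pinned]

theorem pinned_one (hn : (1 : Fin n) ≠ 0) (x : PinIdx n → A) :
    pinned x 1 = ![-(x (Sum.inl 1) * x (Sum.inl 2)), x (Sum.inl 0) * x (Sum.inl 2)] := by
  funext k
  simp [pinned, hn]

theorem pinned_of_ne (x : PinIdx n → A) {v : Fin n} (h0 : v ≠ 0) (h1 : v ≠ 1) (k : Fin 2) :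
    pinned x v k = x (Sum.inr (⟨v, h0, h1⟩, k)) := by
  simp [pinned, h0, h1]

theorem pinned_linear (hn : (1 : Fin n) ≠ 0) (x : PinIdx n → A) :
    x (Sum.inl 0) * pinned x 1 0 + x (Sum.inl 1) * pinned x 1 1 = 0 := by
  simp only [pinned_one hn, Matrix.cons_val_zero, Matrix.cons_val_one]
  ring

theorem map_pinned (f : A →+* B) (x : PinIdx n → A) (v : Fin n) (k : Fin 2) :
    f (pinned x v k) = pinned (fun i => f (x i)) v k := by
  unfold pinned
  split_ifs
  · exact map_zero f
  · fin_cases k <;> simp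
  · rfl

omit [NeZero n] in
theorem map_edgeProd (f : A →+* B) (p : Fin n → Fin 2 → A) (e : Sym2 (Fin n)) :
    f (edgeProd p e) = edgeProd (fun i k => f (p i k)) e := by
  simp [edgeProd]

theorem pinned_eq (hn : (1 : Fin n) ≠ 0) {p : Fin n → Fin 2 → A} {c : Fin 2 → A} {b : A}
    (hb : b * c 0 = 1) (h0 : p 0 = 0) (hl : c 0 * p 1 0 + c 1 * p 1 1 = 0) :
    pinned (Sum.elim ![c 0, c 1, b * p 1 1] fun i => p i.1 i.2) = p := by
  funext v k
  by_cases hv0 : v = 0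
  · rw [hv0, pinned_zero, h0]
  by_cases hv1 : v = 1
  · rw [hv1, pinned_one hn]
    fin_cases k
    · simp only [Sum.elim_inl, Fin.zero_eta, Matrix.cons_val]
      linear_combination p 1 0 * hb - b * hl
    · simp only [Sum.elim_inl, Fin.mk_one, Matrix.cons_val]
      linear_combination p 1 1 * hb
  · rw [pinned_of_ne _ hv0 hv1, Sum.elim_inr]

open MvPolynomial

/-- The edge products of the generic pinned realisation, and the coefficients of its linear
equation. -/
def pinParam (G : SimpleGraph (Fin n)) : G.edgeSet ⊕ Fin 2 → MvPolynomial (PinIdx n) ℂ :=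
  Sum.elim (fun e => edgeProd (pinned X) e) ![X (Sum.inl 0), X (Sum.inl 1)]

theorem map_pinParam_inl {G : SimpleGraph (Fin n)} (f : MvPolynomial (PinIdx n) ℂ →+* A)
    (e : G.edgeSet) :
    f (pinParam G (Sum.inl e)) = edgeProd (pinned fun i => f (X i)) e := by
  simp only [pinParam, Sum.elim_inl, map_edgeProd]
  congr
  funext v k
  exact map_pinned f X v k

theorem pinned_mem_pinnedSolutions (hn : (1 : Fin n) ≠ 0) (G : SimpleGraph (Fin n))
    (f : MvPolynomial (PinIdx n) ℂ →+* A) :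
    (pinned fun i => f (X i)) ∈ pinnedSolutions G (fun e => f (pinParam G (Sum.inl e)))
      (fun i => f (pinParam G (Sum.inr i))) :=
  ⟨pinned_zero _, fun e => (map_pinParam_inl f e).symm, by
    simpa [pinParam] using pinned_linear hn fun i => f (X i)⟩

/-- The parameters of the generic pinned realisation are algebraically independent. -/
theorem IsMinimallyRigidGraph.algebraicIndependent_pinParam {G : SimpleGraph (Fin n)}
    (hG : IsMinimallyRigidGraph G 2) (hn : (1 : Fin n) ≠ 0) (h01 : G.Adj 0 1) :
    AlgebraicIndependent ℂ (pinParam G) := by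
  rw [algebraicIndependent_iff]
  intro P hP
  have hfix (c : Fin 2 → ℂ) (hc₀ : c 0 ≠ 0) (hc₁ : c 1 ≠ 0) :
      aeval (Sum.elim X fun i => C (c i)) P = (0 : MvPolynomial G.edgeSet ℂ) := by
    let Q : MvPolynomial G.edgeSet ℂ := aeval (Sum.elim X fun i => C (c i)) P
    have hQ (a : G.edgeSet → ℂ) : eval a Q = eval (Sum.elim a c) P := by
      rw [← coe_aeval_eq_eval, AlgHom.coe_toRingHom, ← AlgHom.comp_apply, comp_aeval,
        aeval_eq_eval]
      congr 1
      congr 1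
      funext i
      rcases i with i | i <;> simp
    have hQX : Q * X ⟨s(0, 1), h01⟩ = 0 := by
      refine hG.eq_zero_of_eval_edgeProd _ fun p => ?_
      rw [map_mul, eval_X, mul_eq_zero, or_iff_not_imp_right]
      intro hp
      obtain ⟨p', hp0, hpe, hpl, -⟩ := exists_pinned_congruent p hc₀ hc₁ hp
      have h := congrArg (eval (Sum.elim ![c 0, c 1, (c 0)⁻¹ * p' 1 1] fun i => p' i.1 i.2)) hP
      rw [map_zero, ← coe_aeval_eq_eval, AlgHom.coe_toRingHom, ← AlgHom.comp_apply, comp_aeval,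
        aeval_eq_eval] at h
      rw [hQ, ← h]
      congr 1
      congr 1
      funext i
      rcases i with i | i
      · rw [Sum.elim_inl, ← hpe, ← AlgHom.coe_toRingHom, map_pinParam_inl]
        simp [pinned_eq hn (inv_mul_cancel₀ hc₀) hp0 hpl]
      · fin_cases i <;> simp [pinParam]
    exact (mul_eq_zero.mp hQX).resolve_right (X_ne_zero _)
  have hPX : P * (X (Sum.inr 0) * X (Sum.inr 1)) = 0 := by
    refine MvPolynomial.funext fun y => ?_
    rw [map_mul, map_mul, eval_X, eval_X, map_zero, mul_eq_zero, or_iff_not_imp_right]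
    intro hy
    have h := congrArg (eval fun e => y (Sum.inl e)) (hfix (fun i => y (Sum.inr i))
      (left_ne_zero_of_mul hy) (right_ne_zero_of_mul hy))
    rw [map_zero, ← coe_aeval_eq_eval, AlgHom.coe_toRingHom, ← AlgHom.comp_apply, comp_aeval,
      aeval_eq_eval] at h
    rw [← h]
    congr 1
    congr 1
    funext i
    rcases i with i | i <;> simp
  exact (mul_eq_zero.mp hPX).resolve_right (mul_ne_zero (X_ne_zero _) (X_ne_zero _))

end Pinned

section Laurent

variable {K V : Type*} [CommRing K]

theorem LX_mul_LXinv (v : V) : (LX v * LXinv v : LaurentRing K V) = 1 := by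
  simp [LX, LXinv, AddMonoidAlgebra.single_mul_single, AddMonoidAlgebra.one_def]

/-- The Laurent variables and their inverses generate the Laurent polynomial ring. -/
theorem adjoin_LX_union_LXinv :
    Algebra.adjoin K (Set.range LX ∪ Set.range LXinv : Set (LaurentRing K V)) = ⊤ := by
  set S := Algebra.adjoin K (Set.range LX ∪ Set.range LXinv : Set (LaurentRing K V))
  have hmul (m m' : V →₀ ℤ) : (AddMonoidAlgebra.single (m + m') 1 : LaurentRing K V) =
      AddMonoidAlgebra.single m 1 * AddMonoidAlgebra.single m' 1 := by
    rw [AddMonoidAlgebra.single_mul_single, one_mul]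
  have hv (v : V) (k : ℤ) : (AddMonoidAlgebra.single (Finsupp.single v k) 1 : LaurentRing K V) ∈
      S := by
    induction k using Int.induction_on with
    | zero =>
      rw [Finsupp.single_zero]
      exact one_mem S
    | succ k ih =>
      rw [Finsupp.single_add, hmul]
      exact mul_mem ih (Algebra.subset_adjoin (Or.inl ⟨v, rfl⟩))
    | pred k ih =>
      rw [sub_eq_add_neg, Finsupp.single_add, hmul]
      exact mul_mem ih (Algebra.subset_adjoin (Or.inr ⟨v, rfl⟩))
  have hm (m : V →₀ ℤ) : (AddMonoidAlgebra.single m 1 : LaurentRing K V) ∈ S := by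
    induction m using Finsupp.induction_linear with
    | zero => exact one_mem S
    | add m m' h h' => exact hmul m m' ▸ mul_mem h h'
    | single v k => exact hv v k
  refine eq_top_iff.mpr fun x _ => ?_
  induction x using AddMonoidAlgebra.induction_linear with
  | zero => exact zero_mem S
  | add x y hx hy => exact add_mem (hx trivial) (hy trivial)
  | single m r =>
    have : (AddMonoidAlgebra.single m r : LaurentRing K V) =
        r • AddMonoidAlgebra.single m 1 := by simp
    rw [this]
    exact S.smul_mem (hm m) r

theorem LaurentRing.algHom_ext {A : Type*} [CommRing A] [Algebra K A]
    {f g : LaurentRing K V →ₐ[K] A} (h : ∀ v, f (LX v) = g (LX v)) : f = g := by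
  refine AlgHom.ext_of_adjoin_eq_top adjoin_LX_union_LXinv ?_
  rintro _ (⟨v, rfl⟩ | ⟨v, rfl⟩)
  · exact h v
  · refine left_inv_eq_right_inv (a := f (LX v)) ?_ ?_
    · rw [← map_mul, mul_comm, LX_mul_LXinv, map_one]
    · rw [h, ← map_mul, LX_mul_LXinv, map_one]

theorem LaurentRing.exists_algHom {Ω : Type*} [Field Ω] [Algebra K Ω] (z : V → Ω)
    (hz : ∀ v, z v ≠ 0) : ∃ f : LaurentRing K V →ₐ[K] Ω, ∀ v, f (LX v) = z v := by
  let F : Multiplicative (V →₀ ℤ) →* Ω :=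
    { toFun := fun m => m.toAdd.prod fun v k => z v ^ k
      map_one' := Finsupp.prod_zero_index
      map_mul' := fun m m' => Finsupp.prod_add_index' (fun v => zpow_zero _)
        fun v k l => zpow_add₀ (hz v) k l }
  refine ⟨AddMonoidAlgebra.lift K Ω _ F, fun v => ?_⟩
  rw [LX, AddMonoidAlgebra.lift_single, one_smul]
  exact (Finsupp.prod_single_index (zpow_zero _)).trans (zpow_one _)

end Laurent

section CycleIdeal

variable {n : ℕ} [NeZero n] {K : Type*} [CommRing K] {G : SimpleGraph (Fin n)}

/-- The ideal of edge products, a linear equation on the edge `01` and cycle sums. -/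
def cycleIdeal (h01 : G.Adj 0 1) (a : G.edgeSet → K) (c : Fin 2 → K) :
    Ideal (LaurentRing K (G.edgeSet × Fin 2)) :=
  Ideal.span (
    {g | ∃ e : G.edgeSet, g = LX (e, 0) * LX (e, 1) - algebraMap _ _ (a e)} ∪
    {g | g = algebraMap _ _ (c 0) * LX (⟨s(0, 1), G.mem_edgeSet.mpr h01⟩, 0) +
      algebraMap _ _ (c 1) * LX (⟨s(0, 1), G.mem_edgeSet.mpr h01⟩, 1)} ∪
    {g | ∃ (v : Fin n) (w : G.Walk v v), w.IsCycle ∧ ∃ k : Fin 2,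
      g = (w.darts.map fun dd => ydir K dd k).sum})

variable {A : Type*} [CommRing A] [Algebra K A] {h01 : G.Adj 0 1} {a : G.edgeSet → K}
  {c : Fin 2 → K} {f : LaurentRing K (G.edgeSet × Fin 2) →ₐ[K] A}

omit [NeZero n] in
theorem map_ydir {p : Fin n → Fin 2 → A}
    (hf : ∀ (e : G.edgeSet) k, f (LX (e, k)) = p e.1.inf k - p e.1.sup k)
    (d : G.Dart) (k : Fin 2) : f (ydir K d k) = p d.fst k - p d.snd k := by
  have hd : d.edge = s(d.fst, d.snd) := rfl
  unfold ydir
  split_ifs with h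
  · rw [hf]
    simp [hd, h.le]
  · rw [map_neg, hf]
    simp [hd, not_lt.mp h]

/-- An algebra homomorphism given by differences of a pinned solution kills the cycle ideal. -/
theorem cycleIdeal_le_ker {p : Fin n → Fin 2 → A}
    (hp : p ∈ pinnedSolutions G (fun e => algebraMap K A (a e)) fun i => algebraMap K A (c i))
    (hf : ∀ (e : G.edgeSet) k, f (LX (e, k)) = p e.1.inf k - p e.1.sup k) :
    ∀ g ∈ cycleIdeal h01 a c, f g = 0 := by
  change cycleIdeal h01 a c ≤ RingHom.ker f
  refine Ideal.span_le.mpr ?_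
  rintro g ((⟨e, rfl⟩ | rfl) | ⟨v, w, -, k, rfl⟩)
  · simp only [SetLike.mem_coe, RingHom.mem_ker, map_sub, map_mul, AlgHom.commutes, hf]
    exact sub_eq_zero.mpr (hp.2.1 e)
  · have := hp.2.2
    simp only [SetLike.mem_coe, RingHom.mem_ker, map_add, map_mul, AlgHom.commutes, hf]
    simp only [Sym2.inf_mk, Sym2.sup_mk, Fin.zero_le, inf_of_le_left, sup_of_le_right, hp.1,
      Pi.zero_apply]
    linear_combination -this
  · simp only [SetLike.mem_coe, RingHom.mem_ker, map_list_sum, List.map_map]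
    have : (f ∘ fun dd : G.Dart => ydir K dd k) = fun d => p d.fst k - p d.snd k :=
      funext fun d => map_ydir hf d k
    rw [this, sum_darts_sub (fun v => p v k), sub_self]

/-- Every algebra homomorphism killing the cycle ideal comes from a pinned solution. -/
theorem exists_mem_pinnedSolutions (hG : G.Connected) (hf : ∀ g ∈ cycleIdeal h01 a c, f g = 0) :
    ∃ p ∈ pinnedSolutions G (fun e => algebraMap K A (a e)) fun i => algebraMap K A (c i),
      ∀ (e : G.edgeSet) k, f (LX (e, k)) = p e.1.inf k - p e.1.sup k := by
  have hpot (k : Fin 2) : ∃ U : Fin n → A, U 0 = 0 ∧ ∀ d : G.Dart,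
      f (ydir K d k) = U d.fst - U d.snd := by
    refine exists_potential hG (fun d => ?_) (fun v w hw => ?_) 0
    · rw [← map_neg]
      congr 1
      have hne : d.fst ≠ d.snd := d.adj.ne
      simp only [ydir, SimpleGraph.Dart.edge_symm]
      rcases lt_or_gt_of_ne hne with h | h
      · simp [h, h.not_gt]
      · simp [h, h.not_gt]
    · have := hf _ (Ideal.subset_span (Or.inr ⟨v, w, hw, k, rfl⟩))
      rwa [map_list_sum, List.map_map] at this
  choose U hU0 hU using hpot
  have hfU (e : G.edgeSet) (k : Fin 2) :
      f (LX (e, k)) = U k (e : Sym2 (Fin n)).inf - U k (e : Sym2 (Fin n)).sup := by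
    obtain ⟨e, he⟩ := e
    induction e using Sym2.ind with
    | _ i j =>
      have hij : G.Adj i j := he
      have h := hU k ⟨(i, j), hij⟩
      rcases lt_or_gt_of_ne hij.ne with hlt | hlt
      · simpa [ydir, hlt, hlt.le, SimpleGraph.Dart.edge] using h
      · simp [ydir, hlt.not_gt, SimpleGraph.Dart.edge] at h
        simp only [Sym2.inf_mk, Sym2.sup_mk, inf_of_le_right hlt.le, sup_of_le_left hlt.le]
        linear_combination -h
  refine ⟨fun v k => U k v, ⟨funext hU0, fun e => ?_, ?_⟩, hfU⟩
  · have := hf _ (Ideal.subset_span (Or.inl (Or.inl ⟨e, rfl⟩)))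
    rw [map_sub, map_mul, AlgHom.commutes, hfU, hfU] at this
    exact sub_eq_zero.mp this
  · have := hf _ (Ideal.subset_span (Or.inl (Or.inr rfl)))
    rw [map_add, map_mul, map_mul, AlgHom.commutes, AlgHom.commutes, hfU, hfU] at this
    simp only [Sym2.inf_mk, Sym2.sup_mk, Fin.zero_le, inf_of_le_left, sup_of_le_right, hU0] at this
    linear_combination -this

omit [NeZero n] in
/-- Vertex labellings of a connected graph are determined by their differences along edges and
one value. -/
theorem eq_of_edge_differences (hG : G.Connected) {M : Type*} [AddCommGroup M] {p q : Fin n → M}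
    (o : Fin n) (ho : p o = q o)
    (h : ∀ e : G.edgeSet, p (e : Sym2 (Fin n)).inf - p (e : Sym2 (Fin n)).sup =
      q (e : Sym2 (Fin n)).inf - q (e : Sym2 (Fin n)).sup) : p = q := by
  have hadj (i j : Fin n) (hij : G.Adj i j) : p i = q i ↔ p j = q j := by
    have := h ⟨s(i, j), hij⟩
    simp only [Sym2.inf_mk, Sym2.sup_mk] at this
    have hd : p i - p j = q i - q j := by
      rcases le_total i j with hle | hle
      · simpa [hle] using this
      · rw [inf_of_le_right hle, sup_of_le_left hle] at this
        rw [← neg_sub, this, neg_sub]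
    constructor
    · intro hi
      rwa [hi, sub_right_inj] at hd
    · intro hj
      rwa [hj, sub_left_inj] at hd
  funext v
  obtain ⟨w⟩ := hG.preconnected o v
  induction w with
  | nil => exact ho
  | cons hij _ ih => exact ih ((hadj _ _ hij).mp ho)

end CycleIdeal

section GenericRootCount

open MvPolynomial

variable {n : ℕ} [NeZero n] {G : SimpleGraph (Fin n)}

/-- A homomorphism from a ring generated by the coordinate differences of a pinned solution and
their inverses is injective if it maps that solution to one with algebraically independent
coordinates. -/
theorem injective_of_pinned (hn : (1 : Fin n) ≠ 0) {K R Ω : Type*} [Field K] [CommRing R]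
    [Algebra K R] [Field Ω] [Algebra K Ω] [Algebra (MvPolynomial (G.edgeSet ⊕ Fin 2) ℂ) K]
    [IsFractionRing (MvPolynomial (G.edgeSet ⊕ Fin 2) ℂ) K]
    {p : Fin n → Fin 2 → R}
    (hp : p ∈ pinnedSolutions G
      (fun e => algebraMap K R (algebraMap (MvPolynomial (G.edgeSet ⊕ Fin 2) ℂ) K (X (Sum.inl e))))
      (fun i => algebraMap K R (algebraMap (MvPolynomial (G.edgeSet ⊕ Fin 2) ℂ) K (X (Sum.inr i)))))
    {y y' : G.edgeSet × Fin 2 → R} (hpy : ∀ e k, y (e, k) = p e.1.inf k - p e.1.sup k)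
    (hyy' : ∀ i, y i * y' i = 1) (hy : Algebra.adjoin K (Set.range y ∪ Set.range y') = ⊤)
    {ι : MvPolynomial (PinIdx n) ℂ →+* Ω} (hι : Function.Injective ι)
    (hpar : ∀ m : MvPolynomial (G.edgeSet ⊕ Fin 2) ℂ,
      algebraMap K Ω (algebraMap _ K m) = ι (aeval (pinParam G) m))
    (φ : R →ₐ[K] Ω) (hφp : ∀ v k, φ (p v k) = pinned (fun i => ι (X i)) v k) :
    Function.Injective φ := by
  let c : Fin 2 → K := fun i => algebraMap (MvPolynomial (G.edgeSet ⊕ Fin 2) ℂ) K (X (Sum.inr i))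
  have hc (i : Fin 2) : algebraMap K Ω (c i) = ι (pinParam G (Sum.inr i)) := by
    rw [hpar, aeval_X]
  have hc₀ : c 0 ≠ 0 := fun h => by
    have := hc 0
    rw [h, map_zero, eq_comm, map_eq_zero_iff ι hι] at this
    exact X_ne_zero _ this
  let b : R := algebraMap K R (c 0)⁻¹
  have hb : b * algebraMap K R (c 0) = 1 := by
    rw [← map_mul, inv_mul_cancel₀ hc₀, map_one]
  let x : PinIdx n → R :=
    Sum.elim ![algebraMap K R (c 0), algebraMap K R (c 1), b * p 1 1] fun i => p i.1 i.2
  have hx : pinned x = p := pinned_eq hn (c := fun i => algebraMap K R (c i)) hb hp.1 hp.2.2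
  let j : MvPolynomial (PinIdx n) ℂ →+* R :=
    eval₂Hom (((algebraMap K R).comp (algebraMap (MvPolynomial (G.edgeSet ⊕ Fin 2) ℂ) K)).comp C) x
  have hjX (i) : j (X i) = x i := eval₂Hom_X' _ _ i
  have hφj : (φ : R →+* Ω).comp j = ι := by
    refine MvPolynomial.ringHom_ext (fun z => ?_) fun i => ?_
    · have := hpar (C z)
      rw [aeval_C, algebraMap_eq] at this
      rw [RingHom.comp_apply, eval₂Hom_C, ← this]
      exact φ.commutes _
    · rw [RingHom.comp_apply, hjX]
      have h11 := hφp 1 1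
      rw [pinned_one hn] at h11
      have hc0 := hc 0
      have hc1 := hc 1
      simp only [pinParam, Sum.elim_inr, Matrix.cons_val_zero, Matrix.cons_val_one] at hc0 hc1 h11
      rcases i with i | ⟨⟨v, hv⟩, k⟩
      · fin_cases i
        · exact (φ.commutes _).trans hc0
        · exact (φ.commutes _).trans hc1
        · change φ (b * p 1 1) = ι (X (Sum.inl 2))
          rw [map_mul, h11, φ.commutes, map_inv₀, hc0, inv_mul_cancel_left₀]
          exact (map_ne_zero_iff ι hι).mpr (X_ne_zero _)
      · exact (hφp v k).trans (pinned_of_ne _ hv.1 hv.2 k)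
  have hjpar (m) : j (aeval (pinParam G) m) =
      algebraMap K R (algebraMap (MvPolynomial (G.edgeSet ⊕ Fin 2) ℂ) K m) := by
    have : (j.comp (aeval (pinParam G)).toRingHom) =
        (algebraMap K R).comp (algebraMap (MvPolynomial (G.edgeSet ⊕ Fin 2) ℂ) K) := by
      refine MvPolynomial.ringHom_ext (fun z => ?_) fun i => ?_
      · simp [j]
      · rw [RingHom.comp_apply, AlgHom.toRingHom_eq_coe, AlgHom.coe_toRingHom, aeval_X]
        rcases i with i | i
        · rw [map_pinParam_inl]
          simp only [hjX, hx]
          exact hp.2.1 i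
        · fin_cases i <;> simp [pinParam, hjX, x, c]
    exact RingHom.congr_fun this m
  have hjy (e : G.edgeSet) (k : Fin 2) :
      j (pinned X e.1.inf k - pinned X e.1.sup k) = y (e, k) := by
    rw [map_sub, map_pinned, map_pinned]
    simp only [hjX, hx]
    exact (hpy e k).symm
  let D : Subalgebra K R :=
    { carrier := {r | ∃ t q, IsUnit (j t) ∧ j t * r = j q}
      mul_mem' := by
        rintro r r' ⟨t, q, ht, h⟩ ⟨t', q', ht', h'⟩
        exact ⟨t * t', q * q', by rw [map_mul]; exact ht.mul ht', by
          rw [map_mul, map_mul, ← h, ← h']; ring⟩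
      add_mem' := by
        rintro r r' ⟨t, q, ht, h⟩ ⟨t', q', ht', h'⟩
        exact ⟨t * t', t' * q + t * q', by rw [map_mul]; exact ht.mul ht', by
          rw [map_mul, map_add, map_mul, map_mul, ← h, ← h']; ring⟩
      algebraMap_mem' := by
        intro κ
        obtain ⟨N, d, hd, rfl⟩ := IsFractionRing.div_surjective
          (A := MvPolynomial (G.edgeSet ⊕ Fin 2) ℂ) κ
        have hd0 : algebraMap (MvPolynomial (G.edgeSet ⊕ Fin 2) ℂ) K d ≠ 0 :=
          IsFractionRing.to_map_ne_zero_of_mem_nonZeroDivisors hd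
        refine ⟨aeval (pinParam G) d, aeval (pinParam G) N, ?_, ?_⟩
        · rw [hjpar]
          exact (IsUnit.mk0 _ hd0).map _
        · rw [hjpar, hjpar, ← map_mul, mul_div_cancel₀ _ hd0] }
  have hD : D = ⊤ := by
    rw [eq_top_iff, ← hy]
    refine Algebra.adjoin_le ?_
    rintro _ (⟨⟨e, k⟩, rfl⟩ | ⟨⟨e, k⟩, rfl⟩)
    · exact ⟨1, pinned X e.1.inf k - pinned X e.1.sup k, by simp, by rw [map_one, one_mul, hjy]⟩
    · have hu : j (pinned X e.1.inf k - pinned X e.1.sup k) * y' (e, k) = 1 := by rw [hjy, hyy']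
      exact ⟨_, 1, IsUnit.of_mul_eq_one _ hu, by rw [hu, map_one]⟩
  refine (injective_iff_map_eq_zero φ).mpr fun r hr => ?_
  obtain ⟨t, q, ht, h⟩ : r ∈ D := hD ▸ Algebra.mem_top
  have hq : ι q = 0 := by
    rw [← hφj]
    change φ (j q) = 0
    rw [← h, map_mul, hr, mul_zero]
  rw [(map_eq_zero_iff ι hι).mp hq, map_zero] at h
  exact ht.mul_right_eq_zero.mp h

/-- The coordinate ring of the cycle ideal with generic parameters. -/
abbrev GenericQuotient (h01 : G.Adj 0 1) : Type :=
  LaurentRing (RatFuncField (G.edgeSet ⊕ Fin 2)) (G.edgeSet × Fin 2) ⧸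
    cycleIdeal h01 (fun e => ratParam (P := G.edgeSet ⊕ Fin 2) (Sum.inl e))
      (fun i => ratParam (P := G.edgeSet ⊕ Fin 2) (Sum.inr i))

/-- The classes of the Laurent variables in the generic coordinate ring. -/
def genericVar (h01 : G.Adj 0 1) (i : G.edgeSet × Fin 2) : GenericQuotient h01 :=
  Ideal.Quotient.mk _ (LX i)

variable {h01 : G.Adj 0 1} {Ω : Type*} [Field Ω] [Algebra (RatFuncField (G.edgeSet ⊕ Fin 2)) Ω]

theorem exists_mem_pinnedSolutions_of_algHom (hG : G.Connected) {A : Type*} [CommRing A]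
    [Algebra (RatFuncField (G.edgeSet ⊕ Fin 2)) A]
    (φ : GenericQuotient h01 →ₐ[RatFuncField (G.edgeSet ⊕ Fin 2)] A) :
    ∃ p ∈ pinnedSolutions G
        (fun e => algebraMap _ A (ratParam (P := G.edgeSet ⊕ Fin 2) (Sum.inl e)))
        (fun i => algebraMap _ A (ratParam (P := G.edgeSet ⊕ Fin 2) (Sum.inr i))),
      ∀ (e : G.edgeSet) k, φ (genericVar h01 (e, k)) = p e.1.inf k - p e.1.sup k := by
  refine exists_mem_pinnedSolutions (h01 := h01) hG
    (f := φ.comp (Ideal.Quotient.mkₐ (RatFuncField (G.edgeSet ⊕ Fin 2)) _)) fun g hg => ?_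
  rw [AlgHom.comp_apply, Ideal.Quotient.mkₐ_eq_mk, Ideal.Quotient.eq_zero_iff_mem.mpr hg, map_zero]

/-- Homomorphisms from the generic coordinate ring to a field correspond to pinned solutions. -/
theorem exists_bijective_algHom (hG : G.Connected) {b : G.edgeSet ⊕ Fin 2 → Ω}
    (hb : ∀ i, algebraMap (RatFuncField (G.edgeSet ⊕ Fin 2)) Ω (ratParam i) = b i)
    (ha : ∀ e, b (Sum.inl e) ≠ 0) :
    ∃ F : pinnedSolutions G (fun e => b (Sum.inl e)) (fun i => b (Sum.inr i)) →
        GenericQuotient h01 →ₐ[RatFuncField (G.edgeSet ⊕ Fin 2)] Ω,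
      Function.Bijective F ∧ ∀ p (e : G.edgeSet) k,
        F p (genericVar h01 (e, k)) = p.1 e.1.inf k - p.1 e.1.sup k := by
  obtain rfl := funext hb
  have hex (p : pinnedSolutions G
      (fun e => algebraMap _ Ω (ratParam (P := G.edgeSet ⊕ Fin 2) (Sum.inl e)))
      (fun i => algebraMap _ Ω (ratParam (P := G.edgeSet ⊕ Fin 2) (Sum.inr i)))) :
      ∃ φ : GenericQuotient h01 →ₐ[RatFuncField (G.edgeSet ⊕ Fin 2)] Ω, ∀ (e : G.edgeSet) k,
        φ (genericVar h01 (e, k)) = p.1 e.1.inf k - p.1 e.1.sup k := by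
    obtain ⟨f, hf⟩ := LaurentRing.exists_algHom (K := RatFuncField (G.edgeSet ⊕ Fin 2))
      (fun i : G.edgeSet × Fin 2 => p.1 i.1.1.inf i.2 - p.1 i.1.1.sup i.2) (by
        rintro ⟨e, k⟩ h
        refine ha e ((p.2.2.1 e).symm.trans ?_)
        rw [edgeProd]
        fin_cases k
        · exact mul_eq_zero_of_left h _
        · exact mul_eq_zero_of_right _ h)
    exact ⟨Ideal.Quotient.liftₐ _ f (cycleIdeal_le_ker p.2 fun e k => hf (e, k)),
      fun e k => hf (e, k)⟩
  choose F hF using hex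
  refine ⟨F, ⟨fun p q hpq => ?_, fun φ => ?_⟩, hF⟩
  · refine Subtype.ext ?_
    have h (k : Fin 2) : (fun v => p.1 v k) = fun v => q.1 v k :=
      eq_of_edge_differences hG 0 (by rw [p.2.1, q.2.1]) fun e => by rw [← hF, ← hF, hpq]
    funext v k
    exact congrFun (h k) v
  · obtain ⟨p, hp, hφ⟩ := exists_mem_pinnedSolutions_of_algHom hG φ
    refine ⟨⟨p, hp⟩, Ideal.Quotient.algHom_ext _ (LaurentRing.algHom_ext ?_)⟩
    rintro ⟨e, k⟩
    exact (hF _ e k).trans (hφ e k).symm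

/-- If the pinned solutions with generic parameters are finite in number, they are counted by the
rank of the generic coordinate ring, and none of them satisfies the linear equation everywhere. -/
theorem finrank_genericQuotient {Ω : Type*} [Field Ω] [IsAlgClosed Ω] (hG : G.Connected)
    (hn : 3 ≤ n) (h01 : G.Adj 0 1) {ι : MvPolynomial (PinIdx n) ℂ →+* Ω}
    (hι : Function.Injective ι) (hpar : AlgebraicIndependent ℂ (pinParam G))
    (hfin : (pinnedSolutions G (fun e => ι (pinParam G (Sum.inl e)))
      fun i => ι (pinParam G (Sum.inr i))).Finite) :
    Module.finrank (RatFuncField (G.edgeSet ⊕ Fin 2)) (GenericQuotient h01) =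
        (pinnedSolutions G (fun e => ι (pinParam G (Sum.inl e)))
          fun i => ι (pinParam G (Sum.inr i))).ncard ∧
      ∀ p ∈ pinnedSolutions G (fun e => ι (pinParam G (Sum.inl e)))
          fun i => ι (pinParam G (Sum.inr i)),
        ∃ v, ι (pinParam G (Sum.inr 0)) * p v 0 + ι (pinParam G (Sum.inr 1)) * p v 1 ≠ 0 := by
  have hn1 : (1 : Fin n) ≠ 0 := h01.ne'
  let K := RatFuncField (G.edgeSet ⊕ Fin 2)
  let R := GenericQuotient h01
  have hinj : Function.Injective (ι.comp (aeval (pinParam G)).toRingHom) :=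
    fun _ _ h => hpar (hι h)
  let θ : K →+* Ω := IsFractionRing.lift (A := MvPolynomial (G.edgeSet ⊕ Fin 2) ℂ) hinj
  let _ : Algebra K Ω := θ.toAlgebra
  have hθ (m : MvPolynomial (G.edgeSet ⊕ Fin 2) ℂ) :
      algebraMap K Ω (algebraMap _ _ m) = ι (aeval (pinParam G) m) :=
    IsFractionRing.lift_algebraMap hinj m
  have hparam (i) : algebraMap K Ω (ratParam i) = ι (pinParam G i) := by
    rw [ratParam, hθ, aeval_X]
  have hne (i) : ι (pinParam G i) ≠ 0 := (map_ne_zero_iff ι hι).mpr (hpar.ne_zero i)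
  obtain ⟨F, hF, hFy⟩ := exists_bijective_algHom (h01 := h01) hG hparam fun e => hne _
  let S := pinnedSolutions G (fun e => ι (pinParam G (Sum.inl e)))
    fun i => ι (pinParam G (Sum.inr i))
  obtain ⟨P, hP, hPy⟩ := exists_mem_pinnedSolutions_of_algHom (h01 := h01) hG (AlgHom.id K R)
  have hFP (s : S) (v : Fin n) (k : Fin 2) : F s (P v k) = s.1 v k := by
    refine congrFun (f := fun v => F s (P v k)) (g := fun v => s.1 v k)
      (eq_of_edge_differences hG 0 ?_ fun e => ?_) v
    · rw [hP.1, s.2.1, Pi.zero_apply, map_zero, Pi.zero_apply]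
    · rw [← map_sub, ← hPy, AlgHom.id_apply, hFy]
  let s₀ : S := ⟨pinned fun i => ι (X i), pinned_mem_pinnedSolutions hn1 G ι⟩
  have hgen : Algebra.adjoin K (Set.range (genericVar h01) ∪
      Set.range fun i => (Ideal.Quotient.mk _ (LXinv i) : R)) = ⊤ := by
    have h := congrArg (Subalgebra.map (Ideal.Quotient.mkₐ K (cycleIdeal h01
      (fun e => ratParam (P := G.edgeSet ⊕ Fin 2) (Sum.inl e))
      (fun i => ratParam (P := G.edgeSet ⊕ Fin 2) (Sum.inr i)))))
      (adjoin_LX_union_LXinv (K := K) (V := G.edgeSet × Fin 2))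
    rwa [AlgHom.map_adjoin, Algebra.map_top, (AlgHom.range_eq_top _).mpr
      (Ideal.Quotient.mkₐ_surjective _ _), Set.image_union, ← Set.range_comp, ← Set.range_comp] at h
  have hφ : Function.Injective (F s₀) := by
    refine injective_of_pinned (G := G) hn1 hP (fun e k => hPy e k) (fun i => ?_) hgen hι hθ (F s₀)
      (hFP s₀)
    rw [genericVar, ← map_mul, LX_mul_LXinv, map_one]
  have : IsDomain R := hφ.isDomain (F s₀).toRingHom
  have : Finite S := hfin.to_subtype
  have : Finite (R →ₐ[K] Ω) := Finite.of_surjective F hF.2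
  have : CharZero K := charZero_of_injective_ringHom (algebraMap ℂ K).injective
  obtain ⟨hfield, hrank⟩ := isField_and_finrank_eq_card_algHom (F s₀) hφ
  refine ⟨hrank.trans ((Nat.card_eq_of_bijective F hF).symm.trans (Nat.card_coe_set_eq S)),
    fun p hp => ?_⟩
  by_contra! hall
  have hPall (v : Fin n) : algebraMap K R (ratParam (Sum.inr 0)) * P v 0 +
      algebraMap K R (ratParam (Sum.inr 1)) * P v 1 = 0 := by
    by_contra hne
    obtain ⟨b, hb⟩ := hfield.mul_inv_cancel hne
    have h := congrArg (F ⟨p, hp⟩) hb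
    rw [map_mul, map_add, map_mul, map_mul, AlgHom.commutes, AlgHom.commutes, hFP, hFP, hparam,
      hparam, hall, zero_mul, map_one] at h
    exact zero_ne_one h
  let two : Fin n := ⟨2, hn⟩
  have h0 : two ≠ 0 := by simp [two, Fin.ext_iff]
  have h1 : two ≠ 1 := by
    rw [Ne, Fin.ext_iff, Fin.val_one', Nat.mod_eq_of_lt (by lia)]
    simp [two]
  have h := congrArg (F s₀) (hPall two)
  rw [map_add, map_mul, map_mul, AlgHom.commutes, AlgHom.commutes, hFP, hFP, hparam, hparam,
    map_zero] at h
  simp only [s₀, pinned_of_ne _ h0 h1, pinParam, Sum.elim_inr, Matrix.cons_val_zero,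
    Matrix.cons_val_one, ← map_mul, ← map_add] at h
  have h := congrArg (eval fun _ => (1 : ℂ)) ((map_eq_zero_iff ι hι).mp h)
  norm_num at h

end GenericRootCount

theorem exists_pinned_eq {n : ℕ} [NeZero n] (hn : (1 : Fin n) ≠ 0) {A : Type*} [CommRing A]
    {p : Fin n → Fin 2 → A} (hp : p 0 = 0) : ∃ x : PinIdx n → A, pinned x = p := by
  refine ⟨Sum.elim ![p 1 1, -p 1 0, 1] fun i => p i.1 i.2, ?_⟩
  funext v k
  by_cases hv0 : v = 0
  · rw [hv0, pinned_zero, hp]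
  by_cases hv1 : v = 1
  · rw [hv1, pinned_one hn]
    fin_cases k <;> simp
  · rw [pinned_of_ne _ hv0 hv1, Sum.elim_inr]

theorem edgeProd_toIsotropic_add_const {n : ℕ} (p : Fin n → Fin 2 → ℂ) (z : Fin 2 → ℂ)
    (e : Sym2 (Fin n)) : edgeProd (toIsotropic fun i => ofIsotropic p i + z) e = edgeProd p e := by
  conv_rhs => rw [← toIsotropic_ofIsotropic p]
  simp only [edgeProd, toIsotropic, Pi.add_apply, Matrix.cons_val_zero, Matrix.cons_val_one]
  ring

open MvPolynomial in
/-- A generic pinned realisation has algebraically independent coordinates, and it can be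
translated so that a given nonzero polynomial does not vanish on it. -/
theorem exists_generic_pinned {n : ℕ} [NeZero n] (hn : (1 : Fin n) ≠ 0)
    {f : MvPolynomial (Fin n × Fin 2) ℂ} (hf : f ≠ 0) :
    ∃ (ι : MvPolynomial (PinIdx n) ℂ →+* ℂ) (z : Fin 2 → ℂ), Function.Injective ι ∧
      eval (fun v => (ofIsotropic (pinned fun i => ι (X i)) v.1 + z) v.2) f ≠ 0 := by
  obtain ⟨r, hr⟩ := exists_eval_ne_zero hf
  let z : Fin 2 → ℂ := fun k => r (0, k)
  let g : Fin n × Fin 2 → MvPolynomial (PinIdx n) ℂ := fun v =>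
    (![C (2⁻¹) * (pinned X v.1 0 + pinned X v.1 1),
      C (-Complex.I / 2) * (pinned X v.1 0 - pinned X v.1 1)] : Fin 2 → _) v.2 + C (z v.2)
  have hg (x : PinIdx n → ℂ) : eval x (aeval g f) =
      eval (fun v => (ofIsotropic (pinned x) v.1 + z) v.2) f := by
    rw [← coe_aeval_eq_eval, AlgHom.coe_toRingHom, ← AlgHom.comp_apply, comp_aeval, aeval_eq_eval]
    congr 1
    congr 1
    funext ⟨v, k⟩
    have h (k) : eval x (pinned X v k : MvPolynomial (PinIdx n) ℂ) = pinned x v k := by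
      simpa using map_pinned (eval x) X v k
    fin_cases k <;> simp [g, h, ofIsotropic] <;> ring
  let q : Fin n → Fin 2 → ℂ := fun i k => r (i, k) - z k
  have hq : toIsotropic q 0 = 0 := by
    funext k
    fin_cases k <;> simp [toIsotropic, q, z]
  obtain ⟨x, hx⟩ := exists_pinned_eq hn hq
  have hgf : aeval g f ≠ 0 := by
    intro h
    refine hr ?_
    have h := congrArg (eval x) h
    rw [map_zero, hg, hx, ofIsotropic_toIsotropic] at h
    rw [← h]
    congr 1
    congr 1
    funext v
    simp [q]
  obtain ⟨ι, hι, h⟩ := exists_injective_ringHom_complex _ hgf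
  exact ⟨ι, z, hι, by rwa [hg] at h⟩

theorem IsMinimallyRigidGraph.finrank_genericQuotient_eq_four_mul {n : ℕ} [NeZero n] (hn : 3 ≤ n)
    {G : SimpleGraph (Fin n)} (h12 : G.Adj 0 1) (hG : IsMinimallyRigidGraph G 2)
    {c : ℕ} (hc : IsRealisationNumber G 2 c) :
    Module.finrank (RatFuncField (G.edgeSet ⊕ Fin 2)) (GenericQuotient h12) = 4 * c := by
  have hn1 : (1 : Fin n) ≠ 0 := h12.ne'
  have hpar := hG.algebraicIndependent_pinParam hn1 h12
  obtain ⟨hcpos, f, hf, hfib⟩ := hc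
  obtain ⟨ι, z, hι, hιf⟩ := exists_generic_pinned hn1 hf
  have hne (i) : ι (pinParam G i) ≠ 0 := (map_ne_zero_iff ι hι).mpr (hpar.ne_zero i)
  let x : Fin n → Fin 2 → ℂ := pinned fun j => ι (MvPolynomial.X j)
  let q₀ : Fin n → Fin 2 → ℂ := fun i => ofIsotropic x i + z
  have hcard : (congClasses {q | rigidityMap G 2 q = rigidityMap G 2 q₀}).ncard = c := hfib q₀ hιf
  have ha (e : G.edgeSet) : ι (pinParam G (Sum.inl e)) = edgeProd (toIsotropic q₀) e :=
    (map_pinParam_inl ι e).trans (edgeProd_toIsotropic_add_const x z e).symm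
  obtain ⟨hfinite, hfour⟩ := ncard_pinnedSolutions h12 (c := fun i => ι (pinParam G (Sum.inr i)))
    ha (fun e => hne _) (hne _) (hne _) (Set.finite_of_ncard_pos (hcard ▸ hcpos))
  obtain ⟨hrank, hasym⟩ := finrank_genericQuotient hG.1.connected hn h12 hι hpar hfinite
  rw [hrank, hfour hasym, hcard]

/-- For a minimally 2-rigid graph `G` with `n ≥ 3` labelled so that
`12 ∈ E`, the generic root count of the system `I'_E` (with `y_{ij,1}·y_{ij,2} - a_{ij}`,
one pinning polynomial for the edge `12`, and cycle polynomials) equals `4·c₂(G)`. -/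
theorem statement_13 {n : ℕ} [NeZero n] (hn : 3 ≤ n)
    (G : SimpleGraph (Fin n)) (h12 : G.Adj 0 1)
    (hG : IsMinimallyRigidGraph G 2)
    (c : ℕ) (hc : IsRealisationNumber G 2 c) :
    Module.finrank (RatFuncField (↥G.edgeSet ⊕ Fin 2))
      (LaurentRing (RatFuncField (↥G.edgeSet ⊕ Fin 2)) (↥G.edgeSet × Fin 2) ⧸
        Ideal.span (
          {g : LaurentRing (RatFuncField (↥G.edgeSet ⊕ Fin 2)) (↥G.edgeSet × Fin 2) |
            ∃ e : ↥G.edgeSet,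
              g = LX (e, (0 : Fin 2)) * LX (e, (1 : Fin 2)) -
                algebraMap _ _ (ratParam (P := ↥G.edgeSet ⊕ Fin 2) (Sum.inl e))} ∪
          {g : LaurentRing (RatFuncField (↥G.edgeSet ⊕ Fin 2)) (↥G.edgeSet × Fin 2) |
            g = algebraMap _ _ (ratParam (P := ↥G.edgeSet ⊕ Fin 2) (Sum.inr (0 : Fin 2))) *
                  LX ((⟨s(0, 1), G.mem_edgeSet.mpr h12⟩ : ↥G.edgeSet), (0 : Fin 2)) +
                algebraMap _ _ (ratParam (P := ↥G.edgeSet ⊕ Fin 2) (Sum.inr (1 : Fin 2))) *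
                  LX ((⟨s(0, 1), G.mem_edgeSet.mpr h12⟩ : ↥G.edgeSet), (1 : Fin 2))} ∪
          {g : LaurentRing (RatFuncField (↥G.edgeSet ⊕ Fin 2)) (↥G.edgeSet × Fin 2) |
            ∃ (v : Fin n) (w : G.Walk v v), w.IsCycle ∧ ∃ k : Fin 2,
              g = (w.darts.map fun dd =>
                ydir (RatFuncField (↥G.edgeSet ⊕ Fin 2)) dd k).sum})) =
      4 * c := by
  exact hG.finrank_genericQuotient_eq_four_mul hn h12 hc

end PaperDefs
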